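/- arXiv:2305.10778 — 8 statements merged into one kernel-verified Lean document; each statement's English description precedes it below -/
import Mathlib

section
/- The last mesh width of the Bakhvalov-type mesh satisfies (7/4) ρ ε N^{-1} ≤ h_{x,N} ≤ 3 ρ ε N^{-1}; in particular there exist positive constants C₁, C₂ depending only on ρ such that C₁ ε N^{-1} ≤ h_{x,N} ≤ C₂ ε N^{-1} for all admissible N and ε. -/
/-- Bakhvalov-type mesh generating function. -/
noncomputable def phiB (ρ ε d : ℝ) : ℝ :=
  if d ≤ 1/2 then 2*(1 - ρ*ε*Real.log (1/ε))*d
  else 1 + ρ*ε*Real.log (1 - 2*(1-ε)*(1-d))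

/-- Bakhvalov-type mesh points `x_i = φ(i/N)`. -/
noncomputable def xpt (ρ ε : ℝ) (N i : ℕ) : ℝ := phiB ρ ε ((i : ℝ)/(N : ℝ))

/-- Mesh widths `h_{x,i} = x_i - x_{i-1}`. -/
noncomputable def hx (ρ ε : ℝ) (N i : ℕ) : ℝ := xpt ρ ε N i - xpt ρ ε N (i-1)

/-- The last mesh width is a logarithm of the distance to the boundary in the mesh parameter. -/
theorem hx_last_eq (ρ ε : ℝ) {N : ℕ} (hN : 3 ≤ N) :
    hx ρ ε N N = -(ρ * ε * Real.log (1 - 2 * (1 - ε) * (N : ℝ)⁻¹)) := by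
  have hN' : (3 : ℝ) ≤ N := by exact_mod_cast hN
  have hN0 : (N : ℝ) ≠ 0 := by positivity
  have hdiv : ((N - 1 : ℕ) : ℝ) / (N : ℝ) = 1 - (N : ℝ)⁻¹ := by
    rw [Nat.cast_sub (by omega)]
    field_simp
    simp
  have hinv : (N : ℝ)⁻¹ ≤ 3⁻¹ := inv_anti₀ (by norm_num) hN'
  unfold hx xpt phiB
  rw [hdiv, div_self hN0, if_neg (by norm_num), if_neg (by norm_num at hinv ⊢; linarith)]
  simp

theorem hx_last_bounds {ρ ε : ℝ} {N : ℕ} (hρ : 0 ≤ ρ) (hN : 8 ≤ N) (hε : 0 < ε)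
    (hεN : ε ≤ (N : ℝ)⁻¹) :
    (7/4) * ρ * ε * (N : ℝ)⁻¹ ≤ hx ρ ε N N ∧ hx ρ ε N N ≤ 3 * ρ * ε * (N : ℝ)⁻¹ := by
  rw [hx_last_eq ρ ε (by omega)]
  have hN' : (8 : ℝ) ≤ N := by exact_mod_cast hN
  have hinv : (N : ℝ)⁻¹ ≤ 8⁻¹ := inv_anti₀ (by norm_num) hN'
  have hn : 0 < (N : ℝ)⁻¹ := by positivity
  generalize (N : ℝ)⁻¹ = n at *
  have hlow : 7 / 4 * n ≤ 2 * (1 - ε) * n := by nlinarith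
  have hupp : 2 * (1 - ε) * n ≤ 2 * n := by nlinarith
  generalize 2 * (1 - ε) * n = t at *
  have ht : 0 < 1 - t := by linarith
  have hlog_le := Real.log_le_sub_one_of_pos ht
  have hle_log := Real.one_sub_inv_le_log_of_pos ht
  have hinv_le : (1 - t)⁻¹ ≤ 1 + 3 * n := by
    rw [inv_le_iff_one_le_mul₀ ht]
    nlinarith
  have hρε : 0 ≤ ρ * ε := by positivity
  constructor
  · nlinarith [mul_le_mul_of_nonneg_left (show 7 / 4 * n ≤ -Real.log (1 - t) by linarith) hρε]
  · nlinarith [mul_le_mul_of_nonneg_left (show -Real.log (1 - t) ≤ 3 * n by linarith) hρε]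

theorem stmt1 (k : ℕ) (hk : 1 ≤ k) (ρ : ℝ) (hρ : (k : ℝ) + 2 ≤ ρ) :
    (∀ (N : ℕ) (ε : ℝ), 8 ≤ N → Even N → 0 < ε → ε ≤ (N : ℝ)⁻¹ →
      ρ * ε * Real.log (1/ε) ≤ 1/2 →
      (7/4) * ρ * ε * (N : ℝ)⁻¹ ≤ hx ρ ε N N ∧ hx ρ ε N N ≤ 3 * ρ * ε * (N : ℝ)⁻¹) ∧
    ∃ C₁ C₂ : ℝ, 0 < C₁ ∧ 0 < C₂ ∧
      ∀ (N : ℕ) (ε : ℝ), 8 ≤ N → Even N → 0 < ε → ε ≤ (N : ℝ)⁻¹ →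
        ρ * ε * Real.log (1/ε) ≤ 1/2 →
        C₁ * ε * (N : ℝ)⁻¹ ≤ hx ρ ε N N ∧ hx ρ ε N N ≤ C₂ * ε * (N : ℝ)⁻¹ := by
  have hρ0 : 0 < ρ := by
    have := Nat.cast_nonneg (α := ℝ) k
    linarith
  refine ⟨fun N ε hN _ hε hεN _ => hx_last_bounds hρ0.le hN hε hεN,
    7 / 4 * ρ, 3 * ρ, by positivity, by positivity,
    fun N ε hN _ hε hεN _ => hx_last_bounds hρ0.le hN hε hεN⟩
end

section
/- The Bakhvalov-type mesh width h_{x,N/2+2} satisfies (1/4) ρ ε ≤ h_{x,N/2+2} ≤ ρ ε. -/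
/-- On the layer part of the mesh, `x_{m+j}` with `N = 2m` in closed form. -/
theorem xpt_layer (ρ ε : ℝ) {m j : ℕ} (hm : 0 < m) (hj : 0 < j) :
    xpt ρ ε (m + m) (m + j) = 1 + ρ * ε * Real.log ((j + ε * (m - j)) / m) := by
  have hm' : (0 : ℝ) < m := by exact_mod_cast hm
  have hj' : (0 : ℝ) < j := by exact_mod_cast hj
  have hd : ¬ ((m + j : ℕ) : ℝ) / ((m + m : ℕ) : ℝ) ≤ 1 / 2 := by
    push_cast
    rw [not_le, div_lt_div_iff₀ two_pos (by linarith)]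
    linarith
  rw [xpt, phiB, if_neg hd]
  congr 3
  push_cast
  field_simp
  ring

/-- The inequalities `1 - a / b ≤ log b - log a ≤ b / a - 1`. -/
theorem log_sub_log_bounds {a b : ℝ} (ha : 0 < a) (hb : 0 < b) :
    1 - a / b ≤ Real.log b - Real.log a ∧ Real.log b - Real.log a ≤ b / a - 1 := by
  rw [← Real.log_div hb.ne' ha.ne']
  refine ⟨?_, Real.log_le_sub_one_of_pos (div_pos hb ha)⟩
  simpa only [inv_div] using Real.one_sub_inv_le_log_of_pos (div_pos hb ha)

theorem stmt3 (k : ℕ) (hk : 1 ≤ k) (ρ : ℝ) (hρ : (k : ℝ) + 2 ≤ ρ)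
    (N : ℕ) (hN : 8 ≤ N) (hNeven : Even N)
    (ε : ℝ) (hε0 : 0 < ε) (hε1 : ε ≤ (N : ℝ)⁻¹)
    (hτ : ρ * ε * Real.log (1/ε) ≤ 1/2) :
    (1/4) * ρ * ε ≤ hx ρ ε N (N/2 + 2) ∧ hx ρ ε N (N/2 + 2) ≤ ρ * ε := by
  obtain ⟨m, rfl⟩ := hNeven
  have hm : 4 ≤ m := by omega
  have hm' : (4 : ℝ) ≤ m := by exact_mod_cast hm
  have hmpos : (0 : ℝ) < m := by linarith
  have hεm : ε * (m + m) ≤ 1 := by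
    rwa [le_inv_comm₀ hε0 (by positivity), inv_eq_one_div, le_div_iff₀ hε0, mul_comm,
      Nat.cast_add] at hε1
  have hε : ε ≤ 1 / 8 := by nlinarith
  have hρε : 0 < ρ * ε := mul_pos (by linarith [k.cast_nonneg (α := ℝ)]) hε0
  have ha : 0 < 1 + ε * ((m : ℝ) - 1) := by nlinarith
  have hb : 0 < 2 + ε * ((m : ℝ) - 2) := by nlinarith
  have hwidth : hx ρ ε (m + m) ((m + m) / 2 + 2) =
      ρ * ε * (Real.log (2 + ε * (m - 2)) - Real.log (1 + ε * (m - 1))) := by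
    rw [hx, show (m + m) / 2 + 2 = m + 2 by omega, show m + 2 - 1 = m + 1 by omega,
      xpt_layer ρ ε (by omega) two_pos, xpt_layer ρ ε (by omega) one_pos]
    push_cast
    rw [Real.log_div hb.ne' hmpos.ne', Real.log_div ha.ne' hmpos.ne']
    ring
  obtain ⟨hlow, hup⟩ := log_sub_log_bounds ha hb
  have hquarter : (1 + ε * ((m : ℝ) - 1)) / (2 + ε * (m - 2)) ≤ 3 / 4 := by
    rw [div_le_iff₀ hb]
    nlinarith
  have htwo : (2 + ε * ((m : ℝ) - 2)) / (1 + ε * (m - 1)) ≤ 2 := by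
    rw [div_le_iff₀ ha]
    nlinarith
  rw [hwidth]
  constructor <;> nlinarith
end

section
/- The Bakhvalov-type mesh width spanning the transition point satisfies (1/2) ρ ε ≤ h_{x,N/2+1} ≤ 2 ρ N^{-1}. -/
/-- The mesh width spanning the transition point, in closed form. -/
theorem hx_transition (ρ ε : ℝ) (hε0 : 0 < ε) (hε1 : ε ≤ 1) (m : ℕ) (hm : 0 < m) :
    hx ρ ε (m + m) ((m + m) / 2 + 1) =
      ρ * ε * Real.log ((ε + (1 - ε) * (2 * ((m + m : ℕ) : ℝ)⁻¹)) / ε) := by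
  have hm' : (0 : ℝ) < m := by exact_mod_cast hm
  have hhalf : (m + m) / 2 = m := by omega
  have hd : (m : ℝ) / ((m + m : ℕ) : ℝ) = 1 / 2 := by
    push_cast
    field_simp
    ring
  have hd' : ((m + 1 : ℕ) : ℝ) / ((m + m : ℕ) : ℝ) = 1 / 2 + ((m + m : ℕ) : ℝ)⁻¹ := by
    push_cast
    field_simp
    ring
  have hn : (0 : ℝ) < ((m + m : ℕ) : ℝ)⁻¹ := by positivity
  have hpos : 0 < ε + (1 - ε) * (2 * ((m + m : ℕ) : ℝ)⁻¹) :=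
    add_pos_of_pos_of_nonneg hε0 (mul_nonneg (by linarith) (by linarith))
  rw [hx, xpt, xpt, hhalf, Nat.add_sub_cancel, hd, hd', phiB, phiB, if_neg (by linarith),
    if_pos le_rfl, Real.log_div hpos.ne' hε0.ne', one_div ε, Real.log_inv,
    show 1 - 2 * (1 - ε) * (1 - (1 / 2 + ((m + m : ℕ) : ℝ)⁻¹)) =
      ε + (1 - ε) * (2 * ((m + m : ℕ) : ℝ)⁻¹) by ring]
  ring

theorem stmt4 (k : ℕ) (hk : 1 ≤ k) (ρ : ℝ) (hρ : (k : ℝ) + 2 ≤ ρ)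
    (N : ℕ) (hN : 8 ≤ N) (hNeven : Even N)
    (ε : ℝ) (hε0 : 0 < ε) (hε1 : ε ≤ (N : ℝ)⁻¹)
    (hτ : ρ * ε * Real.log (1/ε) ≤ 1/2) :
    (1/2) * ρ * ε ≤ hx ρ ε N (N/2 + 1) ∧ hx ρ ε N (N/2 + 1) ≤ 2 * ρ * (N : ℝ)⁻¹ := by
  obtain ⟨m, rfl⟩ := hNeven
  have hn8 : ((m + m : ℕ) : ℝ)⁻¹ ≤ 1 / 8 := by
    rw [one_div]
    exact inv_anti₀ (by norm_num) (by exact_mod_cast hN)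
  rw [hx_transition ρ ε hε0 (by linarith) m (by omega)]
  set n : ℝ := ((m + m : ℕ) : ℝ)⁻¹
  have hρ0 : 0 < ρ := by
    have : (0 : ℝ) ≤ k := k.cast_nonneg
    linarith
  have hρε : 0 < ρ * ε := mul_pos hρ0 hε0
  have hlow : 2 ≤ (ε + (1 - ε) * (2 * n)) / ε := by
    rw [le_div_iff₀ hε0]
    nlinarith
  have hpos : 0 < (ε + (1 - ε) * (2 * n)) / ε := by linarith
  constructor
  · have hlog := Real.one_sub_inv_le_log_of_pos hpos
    have hinv := inv_anti₀ two_pos hlow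
    nlinarith
  · calc ρ * ε * Real.log ((ε + (1 - ε) * (2 * n)) / ε)
        ≤ ρ * ε * ((ε + (1 - ε) * (2 * n)) / ε - 1) :=
          mul_le_mul_of_nonneg_left (Real.log_le_sub_one_of_pos hpos) hρε.le
      _ = ρ * ((1 - ε) * (2 * n)) := by
          field_simp
          ring
      _ ≤ 2 * ρ * n := by
          nlinarith [mul_pos hρε (hε0.trans_le hε1)]
end

section
/- There exist absolute positive constants C₃ and C₄ (independent of ε, N, ρ, k) such that the distance of the mesh point x_{N/2+1} from the outflow boundary satisfies C₃ ρ ε ln N ≤ 1 − x_{N/2+1} ≤ C₄ ρ ε ln N; for example one may take C₃ = 2/5 and C₄ = 1. -/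
/-- The argument of the logarithm at the first mesh point of the layer region lies in `[1/n, 3/n]`. -/
theorem one_sub_layer_arg_mem_Icc {n ε : ℝ} (hn : 2 ≤ n) (hε : 0 ≤ ε) (hεn : ε ≤ n⁻¹) :
    1 - 2 * (1 - ε) * (1 - (n / 2 + 1) / n) ∈ Set.Icc n⁻¹ (3 * n⁻¹) := by
  have hn0 : n ≠ 0 := by positivity
  have hinv : 0 < n⁻¹ := by positivity
  have hinv2 : n⁻¹ ≤ 2⁻¹ := inv_anti₀ two_pos hn
  have heq : 1 - 2 * (1 - ε) * (1 - (n / 2 + 1) / n) = 2 * n⁻¹ + ε * (1 - 2 * n⁻¹) := by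
    field_simp
    ring
  rw [heq]
  constructor <;> nlinarith

theorem neg_log_mem_Icc {n t : ℝ} (hn : 8 ≤ n) (ht : t ∈ Set.Icc n⁻¹ (3 * n⁻¹)) :
    -Real.log t ∈ Set.Icc (2 / 5 * Real.log n) (Real.log n) := by
  have hn0 : 0 < n := by linarith
  have hlower := Real.log_le_log (inv_pos.mpr hn0) ht.1
  have hupper := Real.log_le_log ((inv_pos.mpr hn0).trans_le ht.1) ht.2
  rw [Real.log_mul (by norm_num) (inv_ne_zero hn0.ne')] at hupper
  rw [Real.log_inv] at hlower hupper
  have hpow : (3 : ℝ) ^ 5 ≤ n ^ 3 :=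
    le_trans (by norm_num) (pow_le_pow_left₀ (by norm_num) hn 3)
  have hlog := Real.log_le_log (by norm_num) hpow
  rw [Real.log_pow, Real.log_pow] at hlog
  push_cast at hlog
  constructor <;> linarith

theorem one_sub_xpt_half_add_one {ρ ε : ℝ} {N : ℕ} (hN : 0 < N) (hEven : Even N) :
    1 - xpt ρ ε N (N / 2 + 1) =
      ρ * ε * -Real.log (1 - 2 * (1 - ε) * (1 - ((N : ℝ) / 2 + 1) / N)) := by
  have hN' : (0 : ℝ) < N := by exact_mod_cast hN
  have hcast : ((N / 2 + 1 : ℕ) : ℝ) = (N : ℝ) / 2 + 1 := by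
    rw [Nat.cast_add, Nat.cast_div hEven.two_dvd two_ne_zero]
    norm_num
  have hhalf : ¬((N : ℝ) / 2 + 1) / N ≤ 1 / 2 := by
    rw [not_le, lt_div_iff₀ hN']
    linarith
  rw [xpt, phiB, hcast, if_neg hhalf]
  ring

theorem one_sub_xpt_half_add_one_bounds {ρ ε : ℝ} {N : ℕ} (hρ : 0 ≤ ρ) (hN : 8 ≤ N)
    (hEven : Even N) (hε : 0 ≤ ε) (hεN : ε ≤ (N : ℝ)⁻¹) :
    2 / 5 * ρ * ε * Real.log N ≤ 1 - xpt ρ ε N (N / 2 + 1) ∧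
      1 - xpt ρ ε N (N / 2 + 1) ≤ 1 * ρ * ε * Real.log N := by
  have hN' : (8 : ℝ) ≤ N := by exact_mod_cast hN
  obtain ⟨hl, hu⟩ :=
    neg_log_mem_Icc hN' (one_sub_layer_arg_mem_Icc (by linarith) hε hεN)
  rw [one_sub_xpt_half_add_one (by lia) hEven]
  have hρε : 0 ≤ ρ * ε := mul_nonneg hρ hε
  have hl' := mul_le_mul_of_nonneg_left hl hρε
  have hu' := mul_le_mul_of_nonneg_left hu hρε
  constructor <;> linarith

theorem stmt6 :
    (∃ C₃ C₄ : ℝ, 0 < C₃ ∧ 0 < C₄ ∧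
      ∀ (k : ℕ), 1 ≤ k → ∀ ρ : ℝ, (k : ℝ) + 2 ≤ ρ →
        ∀ (N : ℕ) (ε : ℝ), 8 ≤ N → Even N → 0 < ε → ε ≤ (N : ℝ)⁻¹ →
          ρ * ε * Real.log (1/ε) ≤ 1/2 →
          C₃ * ρ * ε * Real.log N ≤ 1 - xpt ρ ε N (N/2 + 1) ∧
          1 - xpt ρ ε N (N/2 + 1) ≤ C₄ * ρ * ε * Real.log N) ∧
    (∀ (k : ℕ), 1 ≤ k → ∀ ρ : ℝ, (k : ℝ) + 2 ≤ ρ →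
      ∀ (N : ℕ) (ε : ℝ), 8 ≤ N → Even N → 0 < ε → ε ≤ (N : ℝ)⁻¹ →
        ρ * ε * Real.log (1/ε) ≤ 1/2 →
        (2/5) * ρ * ε * Real.log N ≤ 1 - xpt ρ ε N (N/2 + 1) ∧
        1 - xpt ρ ε N (N/2 + 1) ≤ 1 * ρ * ε * Real.log N) := by
  have hbounds : ∀ (k : ℕ), 1 ≤ k → ∀ ρ : ℝ, (k : ℝ) + 2 ≤ ρ →
      ∀ (N : ℕ) (ε : ℝ), 8 ≤ N → Even N → 0 < ε → ε ≤ (N : ℝ)⁻¹ →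
        ρ * ε * Real.log (1/ε) ≤ 1/2 →
        (2/5) * ρ * ε * Real.log N ≤ 1 - xpt ρ ε N (N/2 + 1) ∧
        1 - xpt ρ ε N (N/2 + 1) ≤ 1 * ρ * ε * Real.log N := by
    intro k _ ρ hρ N ε hN hEven hε hεN _
    exact one_sub_xpt_half_add_one_bounds (le_trans (by positivity) hρ) hN hEven hε.le hεN
  exact ⟨⟨2/5, 1, by norm_num, by norm_num, hbounds⟩, hbounds⟩
end

section
/- Existence and uniqueness of the one-dimensional local Gauss–Radau projection: for every interval [a,b] with a < b, every integer k ≥ 1, and every continuous function z : [a,b] → ℝ, there exists a unique polynomial P of degree at most k such that ∫_a^b P(t) t^m dt = ∫_a^b z(t) t^m dt for all m = 0, 1, …, k−1 and P(b) = z(b). -/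
open Polynomial in
/-- If all moments of `p` of order less than `k` vanish, then `p` is orthogonal to every polynomial
of degree less than `k`. -/
theorem integral_eval_mul_eval_eq_zero_of_moments {a b : ℝ} {k : ℕ} {p q : ℝ[X]}
    (hq : q.degree < k) (hp : ∀ m < k, ∫ t in a..b, p.eval t * t ^ m = 0) :
    ∫ t in a..b, p.eval t * q.eval t = 0 := by
  have hsum : ∀ t : ℝ, p.eval t * q.eval t =
      ∑ i ∈ q.support, q.coeff i * (p.eval t * t ^ i) := fun t => by
    rw [eval_eq_sum (p := q), Polynomial.sum, Finset.mul_sum]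
    exact Finset.sum_congr rfl fun i _ => by ring
  simp_rw [hsum]
  rw [intervalIntegral.integral_finsetSum
    fun i _ => Continuous.intervalIntegrable (by fun_prop) _ _]
  refine Finset.sum_eq_zero fun i hi => ?_
  rw [intervalIntegral.integral_const_mul, hp i, mul_zero]
  exact_mod_cast (le_degree_of_mem_supp i hi).trans_lt hq

open Polynomial in
/-- A polynomial of degree at most `k` that vanishes at the right endpoint `b` and whose moments of
order less than `k` on `[a, b]` vanish is zero. -/
theorem eq_zero_of_moments_of_eval_right_eq_zero {a b : ℝ} (hab : a < b) {k : ℕ} {p : ℝ[X]}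
    (hdeg : p.degree < (k + 1 : ℕ)) (hp : ∀ m < k, ∫ t in a..b, p.eval t * t ^ m = 0)
    (hb : p.eval b = 0) : p = 0 := by
  obtain ⟨q, rfl⟩ := dvd_iff_isRoot.mpr hb
  by_contra hne
  have hq0 : q ≠ 0 := right_ne_zero_of_mul hne
  have hqdeg : q.degree < k := by
    rw [degree_mul, degree_X_sub_C, degree_eq_natDegree hq0] at hdeg
    rw [degree_eq_natDegree hq0]
    norm_cast at hdeg ⊢
    omega
  have hint := integral_eval_mul_eval_eq_zero_of_moments hqdeg hp
  obtain ⟨c, hc, hcq⟩ : ∃ c ∈ Set.Ioo a b, q.eval c ≠ 0 := by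
    by_contra! h
    exact hq0 (eq_zero_of_infinite_isRoot q ((Set.Ioo_infinite hab).mono h))
  have hpos : 0 < ∫ t in a..b, (b - t) * q.eval t ^ 2 := by
    refine intervalIntegral.integral_pos hab (by fun_prop)
      (fun t ht => mul_nonneg (sub_nonneg.mpr ht.2) (sq_nonneg _))
      ⟨c, Set.Ioo_subset_Icc_self hc, ?_⟩
    have := sub_pos.mpr hc.2
    positivity
  have hneg : ∫ t in a..b, (b - t) * q.eval t ^ 2 =
      -∫ t in a..b, ((X - C b) * q).eval t * q.eval t := by
    rw [← intervalIntegral.integral_neg]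
    congr 1
    ext t
    simp only [eval_mul, eval_sub, eval_X, eval_C]
    ring
  rw [hneg, hint, neg_zero] at hpos
  exact hpos.false

open Polynomial in
/-- The linear map sending a polynomial of degree at most `k` to its first `k` moments on `[a, b]`
and its value at `b`. -/
noncomputable def gaussRadauMap (a b : ℝ) (k : ℕ) :
    degreeLT ℝ (k + 1) →ₗ[ℝ] (Fin k → ℝ) × ℝ where
  toFun p := (fun m => ∫ t in a..b, (p : ℝ[X]).eval t * t ^ (m : ℕ), (p : ℝ[X]).eval b)
  map_add' p q := by
    refine Prod.ext (funext fun m => ?_) (by simp)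
    simp only [Submodule.coe_add, eval_add, add_mul, Prod.fst_add, Pi.add_apply]
    exact intervalIntegral.integral_add (Continuous.intervalIntegrable (by fun_prop) _ _)
      (Continuous.intervalIntegrable (by fun_prop) _ _)
  map_smul' r p := by
    refine Prod.ext (funext fun m => ?_) (by simp)
    simp [mul_assoc]

theorem gaussRadauMap_bijective {a b : ℝ} (hab : a < b) (k : ℕ) :
    Function.Bijective (gaussRadauMap a b k) := by
  have hinj : Function.Injective (gaussRadauMap a b k) := by
    rw [injective_iff_map_eq_zero]
    rintro ⟨p, hp⟩ h
    obtain ⟨hm, hb⟩ := Prod.ext_iff.mp h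
    exact Subtype.ext (eq_zero_of_moments_of_eval_right_eq_zero hab
      (Polynomial.mem_degreeLT.mp hp) (fun m hmk => congrFun hm ⟨m, hmk⟩) hb)
  have : FiniteDimensional ℝ (Polynomial.degreeLT ℝ (k + 1)) :=
    (Polynomial.degreeLTEquiv ℝ (k + 1)).symm.finiteDimensional
  refine ⟨hinj, (LinearMap.injective_iff_surjective_of_finrank_eq_finrank ?_).mp hinj⟩
  rw [(Polynomial.degreeLTEquiv ℝ (k + 1)).finrank_eq]
  simp

theorem stmt7 (a b : ℝ) (hab : a < b) (k : ℕ) (hk : 1 ≤ k)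
    (z : ℝ → ℝ) (hz : ContinuousOn z (Set.Icc a b)) :
    ∃! P : Polynomial ℝ, P.natDegree ≤ k ∧
      (∀ m : ℕ, m < k → ∫ t in a..b, P.eval t * t ^ m = ∫ t in a..b, z t * t ^ m) ∧
      P.eval b = z b := by
  have hmem : ∀ P : Polynomial ℝ, P ∈ Polynomial.degreeLT ℝ (k + 1) ↔ P.natDegree ≤ k := by
    intro P
    rw [Polynomial.degreeLT_succ_eq_degreeLE, Polynomial.mem_degreeLE,
      Polynomial.natDegree_le_iff_degree_le]
  obtain ⟨⟨P, hP⟩, h, huniq⟩ := (gaussRadauMap_bijective hab k).existsUnique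
    (fun m => ∫ t in a..b, z t * t ^ (m : ℕ), z b)
  obtain ⟨hm, hb⟩ := Prod.ext_iff.mp h
  refine ⟨P, ⟨(hmem P).mp hP, fun m hmk => congrFun hm ⟨m, hmk⟩, hb⟩, ?_⟩
  rintro Q ⟨hQ, hQm, hQb⟩
  exact congrArg Subtype.val (huniq ⟨Q, (hmem Q).mpr hQ⟩
    (Prod.ext (funext fun m => hQm m m.2) hQb))
end

section
/- Uniqueness (hence, by finite-dimensional linear algebra, existence) of the projection π_x⁻: let K = (a₁,a₂) × (b₁,b₂) be a rectangle and let P(x,y) = Σ_{m,n=0}^{k} c_{mn} x^m y^n be a polynomial of degree at most k in each variable. If ∬_K P(x,y) x^m y^n dx dy = 0 for all 0 ≤ m ≤ k−1 and 0 ≤ n ≤ k, and ∫_{b₁}^{b₂} P(a₂, y) y^n dy = 0 for all 0 ≤ n ≤ k, then P is identically zero (all c_{mn} = 0). -/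
open Polynomial in
/-- A polynomial that is orthogonal to all polynomials of degree less than `N`, with respect to a
weight that is positive inside the interval, and that itself has degree less than `N`, vanishes. -/
theorem Polynomial.eq_zero_of_weighted_moments_eq_zero {a b : ℝ} (hab : a < b) {w : ℝ → ℝ}
    (hw : Continuous w) (hpos : ∀ x ∈ Set.Ioo a b, 0 < w x) {N : ℕ} {q : ℝ[X]}
    (hq : q.degree < N) (h : ∀ n < N, ∫ x in a..b, w x * q.eval x * x ^ n = 0) : q = 0 := by
  have hsq : ∫ x in a..b, w x * q.eval x * q.eval x = 0 := by
    have hexp : ∀ x, w x * q.eval x * q.eval x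
        = ∑ i ∈ Finset.range (q.natDegree + 1), q.coeff i * (w x * q.eval x * x ^ i) := by
      intro x
      conv_lhs => rw [mul_comm, eval_eq_sum_range, Finset.sum_mul]
      exact Finset.sum_congr rfl fun i _ => by rw [eval_eq_sum_range]; ring
    simp_rw [hexp]
    rw [intervalIntegral.integral_finsetSum fun i _ =>
      Continuous.intervalIntegrable (by fun_prop) a b]
    refine Finset.sum_eq_zero fun i _ => ?_
    rw [intervalIntegral.integral_const_mul]
    by_cases hi : i < N
    · rw [h i hi, mul_zero]
    · rw [coeff_eq_zero_of_degree_lt (hq.trans_le (by exact_mod_cast not_lt.mp hi)), zero_mul]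
  have hcont : Continuous fun x => w x * q.eval x * q.eval x := by fun_prop
  have hzero : ∀ x ∈ Set.Ioo a b, q.eval x = 0 := by
    intro x hx
    by_contra hne
    refine (intervalIntegral.integral_pos hab hcont.continuousOn ?_
      ⟨x, Set.Ioo_subset_Icc_self hx, ?_⟩).ne' hsq
    · have hcl : Set.Icc a b ⊆ {y | 0 ≤ w y * q.eval y * q.eval y} := by
        rw [← closure_Ioo hab.ne]
        refine closure_minimal (fun y hy => ?_) (isClosed_le continuous_const hcont)
        have := (hpos y hy).le
        simp only [Set.mem_ofPred_eq, mul_assoc]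
        exact mul_nonneg this (mul_self_nonneg _)
      exact fun y hy => hcl (Set.Ioc_subset_Icc_self hy)
    · rw [mul_assoc]
      exact mul_pos (hpos x hx) (mul_self_pos.mpr hne)
  exact eq_zero_of_infinite_isRoot q ((Set.Ioo_infinite hab).mono hzero)

open Polynomial in
/-- A polynomial of degree at most `k` that vanishes at the right endpoint and is orthogonal to
all polynomials of degree less than `k` vanishes. -/
theorem Polynomial.eq_zero_of_gaussRadau {a b : ℝ} (hab : a < b) {k : ℕ} {p : ℝ[X]}
    (hp : p.degree < (k + 1 : ℕ)) (hb : p.eval b = 0)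
    (h : ∀ n < k, ∫ x in a..b, p.eval x * x ^ n = 0) : p = 0 := by
  obtain ⟨r, rfl⟩ := dvd_iff_isRoot.mpr hb
  suffices hr : r = 0 by rw [hr, mul_zero]
  refine eq_zero_of_weighted_moments_eq_zero (N := k) (w := fun x => b - x) hab (by fun_prop)
    (fun x hx => sub_pos.mpr hx.2) ?_ fun n hn => ?_
  · by_cases hr : r = 0
    · simp [hr]
    · rw [degree_eq_natDegree (mul_ne_zero (X_sub_C_ne_zero b) hr),
        natDegree_mul (X_sub_C_ne_zero b) hr, natDegree_X_sub_C] at hp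
      rw [degree_eq_natDegree hr]
      norm_cast at hp ⊢
      omega
  · rw [← neg_eq_zero, ← intervalIntegral.integral_neg, ← h n hn]
    refine intervalIntegral.integral_congr fun x _ => ?_
    simp only [eval_mul, eval_sub, eval_X, eval_C]
    ring

open Polynomial in
theorem Polynomial.degree_sum_fin_monomial_lt {R : Type*} [Semiring R] {N : ℕ} (d : Fin N → R) :
    (∑ i : Fin N, monomial (i : ℕ) (d i)).degree < N := by
  refine (degree_lt_iff_coeff_zero _ _).mpr fun m hm => ?_
  rw [finsetSum_coeff]
  exact Finset.sum_eq_zero fun i _ => coeff_monomial_of_ne _ (by omega)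

open Polynomial in
theorem Polynomial.coeff_sum_fin_monomial {R : Type*} [Semiring R] {N : ℕ} (d : Fin N → R)
    (j : Fin N) :
    (∑ i : Fin N, monomial (i : ℕ) (d i)).coeff j = d j := by
  simp [finsetSum_coeff, coeff_monomial, Fin.val_inj]

open Polynomial in
/-- The coefficients of a polynomial of degree less than `N` are determined by its first `N`
moments. -/
theorem eq_zero_of_sum_mul_integral_pow_eq_zero {a b : ℝ} (hab : a < b) {N : ℕ} (d : Fin N → ℝ)
    (h : ∀ n < N, ∑ j, d j * ∫ y in a..b, y ^ ((j : ℕ) + n) = 0) (j : Fin N) : d j = 0 := by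
  rw [← coeff_sum_fin_monomial d j, eq_zero_of_weighted_moments_eq_zero hab (w := fun _ => 1)
    continuous_const (fun _ _ => one_pos) (degree_sum_fin_monomial_lt d) ?_, coeff_zero]
  intro n hn
  rw [← h n hn]
  simp_rw [one_mul, eval_finsetSum, eval_monomial, Finset.sum_mul, mul_assoc, ← pow_add]
  rw [intervalIntegral.integral_finsetSum fun i _ =>
    Continuous.intervalIntegrable (by fun_prop) a b]
  simp_rw [intervalIntegral.integral_const_mul]

theorem stmt8 (k : ℕ) (hk : 1 ≤ k) (a₁ a₂ b₁ b₂ : ℝ) (ha : a₁ < a₂) (hb : b₁ < b₂)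
    (c : Fin (k+1) → Fin (k+1) → ℝ) (P : ℝ → ℝ → ℝ)
    (hP : ∀ x y : ℝ, P x y = ∑ m : Fin (k+1), ∑ n : Fin (k+1), c m n * x ^ (m : ℕ) * y ^ (n : ℕ))
    (hvol : ∀ m n : ℕ, m < k → n ≤ k →
      ∫ x in a₁..a₂, ∫ y in b₁..b₂, P x y * x ^ m * y ^ n = 0)
    (hedge : ∀ n : ℕ, n ≤ k → ∫ y in b₁..b₂, P a₂ y * y ^ n = 0) :
    ∀ m n : Fin (k+1), c m n = 0 := by
  have hinner (x : ℝ) (m n : ℕ) : ∫ y in b₁..b₂, P x y * x ^ m * y ^ n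
      = ∑ j : Fin (k+1), (∑ i : Fin (k+1), c i j * x ^ ((i : ℕ) + m)) *
          ∫ y in b₁..b₂, y ^ ((j : ℕ) + n) := by
    have hexp (y : ℝ) : P x y * x ^ m * y ^ n
        = ∑ j : Fin (k+1), (∑ i : Fin (k+1), c i j * x ^ ((i : ℕ) + m)) * y ^ ((j : ℕ) + n) := by
      rw [hP, Finset.sum_comm]
      simp_rw [Finset.sum_mul]
      exact Finset.sum_congr rfl fun j _ => Finset.sum_congr rfl fun i _ => by ring
    simp_rw [hexp]
    rw [intervalIntegral.integral_finsetSum fun i _ =>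
      Continuous.intervalIntegrable (by fun_prop) _ _]
    simp_rw [intervalIntegral.integral_const_mul]
  have hright (j : Fin (k+1)) : ∑ i : Fin (k+1), c i j * a₂ ^ (i : ℕ) = 0 := by
    refine eq_zero_of_sum_mul_integral_pow_eq_zero hb
      (fun j => ∑ i : Fin (k+1), c i j * a₂ ^ (i : ℕ)) (fun n hn => ?_) j
    have := hinner a₂ 0 n
    simp only [pow_zero, mul_one, add_zero] at this
    rw [← this, hedge n (Nat.lt_succ_iff.mp hn)]
  have hmoment (m : ℕ) (hm : m < k) (j : Fin (k+1)) :
      ∫ x in a₁..a₂, ∑ i : Fin (k+1), c i j * x ^ ((i : ℕ) + m) = 0 := by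
    refine eq_zero_of_sum_mul_integral_pow_eq_zero hb
      (fun j => ∫ x in a₁..a₂, ∑ i : Fin (k+1), c i j * x ^ ((i : ℕ) + m)) (fun n hn => ?_) j
    rw [← hvol m n hm (Nat.lt_succ_iff.mp hn)]
    simp_rw [hinner]
    rw [intervalIntegral.integral_finsetSum fun i _ =>
      Continuous.intervalIntegrable (by fun_prop) _ _]
    simp_rw [intervalIntegral.integral_mul_const]
  intro m n
  rw [← Polynomial.coeff_sum_fin_monomial (fun i => c i n) m,
    Polynomial.eq_zero_of_gaussRadau ha (Polynomial.degree_sum_fin_monomial_lt _) ?_ ?_,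
    Polynomial.coeff_zero]
  · simpa only [Polynomial.eval_finsetSum, Polynomial.eval_monomial] using hright n
  · intro l hl
    simpa only [Polynomial.eval_finsetSum, Polynomial.eval_monomial, Finset.sum_mul, mul_assoc,
      ← pow_add] using hmoment l hl n
end

section
/- Existence and uniqueness of the projection π⁻: let K = (a₁,a₂) × (b₁,b₂) be a rectangle, k ≥ 1 an integer, and z a continuous function on the closed rectangle. Then there exists a unique polynomial P of degree at most k in each variable such that ∬_K P x^m y^n = ∬_K z x^m y^n for all 0 ≤ m, n ≤ k−1, ∫_{b₁}^{b₂} P(a₂,y) y^n dy = ∫_{b₁}^{b₂} z(a₂,y) y^n dy for all 0 ≤ n ≤ k−1, ∫_{a₁}^{a₂} P(x,b₂) x^m dx = ∫_{a₁}^{a₂} z(x,b₂) x^m dx for all 0 ≤ m ≤ k−1, and P(a₂,b₂) = z(a₂,b₂). -/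
/-- The matrix of the Gauss–Radau functionals on `[a, b]` in the monomial basis: the first `k` rows
hold the moments against `x ^ i`, the last row the point values at `b`. -/
noncomputable def radauMatrix (k : ℕ) (a b : ℝ) : Matrix (Fin (k + 1)) (Fin (k + 1)) ℝ :=
  fun i j => if (i : ℕ) < k then ∫ x in a..b, x ^ (j : ℕ) * x ^ (i : ℕ) else b ^ (j : ℕ)

/-- A polynomial that vanishes at `b` and is orthogonal on `[a, b]` to all polynomials of smaller
degree is zero. -/
theorem Polynomial.eq_zero_of_radau {a b : ℝ} (hab : a < b) {k : ℕ} {q : Polynomial ℝ}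
    (hdeg : q.natDegree ≤ k) (hq : q.eval b = 0)
    (hmom : ∀ i < k, ∫ x in a..b, q.eval x * x ^ i = 0) : q = 0 := by
  obtain ⟨r, rfl⟩ := Polynomial.dvd_iff_isRoot.mpr hq
  suffices hr : r = 0 by simp [hr]
  by_contra hr
  have hrk : r.natDegree < k := by
    rw [Polynomial.natDegree_mul (Polynomial.X_sub_C_ne_zero b) hr,
      Polynomial.natDegree_X_sub_C] at hdeg
    lia
  have horth : ∫ x in a..b, ((Polynomial.X - Polynomial.C b) * r).eval x * r.eval x = 0 := by
    have hexpand : ∀ x : ℝ, ((Polynomial.X - Polynomial.C b) * r).eval x * r.eval x =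
        ∑ i ∈ Finset.range k,
          r.coeff i * (((Polynomial.X - Polynomial.C b) * r).eval x * x ^ i) := fun x => by
      rw [Polynomial.eval_eq_sum_range' hrk x]
      rw [Finset.mul_sum]
      exact Finset.sum_congr rfl fun i _ => by ring
    simp_rw [hexpand]
    rw [intervalIntegral.integral_finsetSum fun i _ =>
      Continuous.intervalIntegrable (by fun_prop) _ _]
    refine Finset.sum_eq_zero fun i hi => ?_
    rw [intervalIntegral.integral_const_mul, hmom i (Finset.mem_range.mp hi), mul_zero]
  have hroots : ∀ x ∈ Set.Ico a b, r.IsRoot x := fun c hc => by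
    by_contra hrc
    refine absurd horth (ne_of_lt ?_)
    rw [← neg_pos, ← intervalIntegral.integral_neg]
    have hform : ∀ x : ℝ, -(((Polynomial.X - Polynomial.C b) * r).eval x * r.eval x) =
        (b - x) * r.eval x ^ 2 := fun x => by simp; ring
    simp_rw [hform]
    refine intervalIntegral.integral_pos hab (by fun_prop)
      (fun x hx => mul_nonneg (sub_nonneg.mpr hx.2) (sq_nonneg _))
      ⟨c, Set.Ico_subset_Icc_self hc, mul_pos (sub_pos.mpr hc.2) (sq_pos_of_ne_zero hrc)⟩
  exact hr (Polynomial.eq_zero_of_infinite_isRoot r ((Set.Ico_infinite hab).mono hroots))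

/-- The Gauss–Radau functionals determine a polynomial of degree at most `k`. -/
theorem isUnit_radauMatrix {a b : ℝ} (hab : a < b) (k : ℕ) : IsUnit (radauMatrix k a b) := by
  rw [← Matrix.mulVec_injective_iff_isUnit, ← Matrix.coe_mulVecLin, injective_iff_map_eq_zero]
  intro v hv
  have hrow : ∀ i, ∑ j, radauMatrix k a b i j * v j = 0 := fun i => congrFun hv i
  have heval : ∀ x : ℝ, (∑ j : Fin (k + 1), Polynomial.monomial (j : ℕ) (v j)).eval x =
      ∑ j : Fin (k + 1), v j * x ^ (j : ℕ) := fun x => by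
    simp [Polynomial.eval_finsetSum]
  have hzero : ∑ j : Fin (k + 1), Polynomial.monomial (j : ℕ) (v j) = 0 := by
    refine Polynomial.eq_zero_of_radau hab (k := k) ?_ ?_ ?_
    · refine Polynomial.natDegree_sum_le_of_forall_le _ _ fun j _ =>
        (Polynomial.natDegree_monomial_le _).trans (Nat.lt_succ_iff.mp j.2)
    · have := hrow (Fin.last k)
      rw [heval, ← this]
      exact Finset.sum_congr rfl fun j _ => by simp [radauMatrix, mul_comm]
    · intro i hi
      simp_rw [heval, Finset.sum_mul]
      rw [intervalIntegral.integral_finsetSum fun j _ =>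
        Continuous.intervalIntegrable (by fun_prop) _ _, ← hrow ⟨i, by lia⟩]
      refine Finset.sum_congr rfl fun j _ => ?_
      simp_rw [mul_assoc]
      rw [intervalIntegral.integral_const_mul, mul_comm]
      simp [radauMatrix, hi]
  ext j
  have hj := congrArg (fun p => Polynomial.coeff p (j : ℕ)) hzero
  simpa [Polynomial.finsetSum_coeff, Polynomial.coeff_monomial, Fin.val_inj] using hj

/-- Linear systems `A * X * B = D` with invertible `A` and `B` are uniquely solvable. -/
theorem Matrix.existsUnique_mul_mul_eq {n R : Type*} [Fintype n] [DecidableEq n] [CommRing R]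
    {A B : Matrix n n R} (hA : IsUnit A) (hB : IsUnit B) (D : Matrix n n R) :
    ∃! X : Matrix n n R, A * X * B = D := by
  obtain ⟨u, rfl⟩ := hA
  obtain ⟨v, rfl⟩ := hB
  refine ⟨(↑u⁻¹ : Matrix n n R) * D * (↑v⁻¹ : Matrix n n R), by simp [mul_assoc], ?_⟩
  rintro X rfl
  simp [mul_assoc]

theorem radauMatrix_mul_mul_eq_iff (k : ℕ) (a₁ a₂ b₁ b₂ : ℝ)
    (c D : Matrix (Fin (k + 1)) (Fin (k + 1)) ℝ) :
    radauMatrix k a₁ a₂ * c * (radauMatrix k b₁ b₂).transpose = D ↔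
      ∀ i j, ∑ m, ∑ n, c m n * radauMatrix k a₁ a₂ i m * radauMatrix k b₁ b₂ j n = D i j := by
  rw [← Matrix.ext_iff]
  refine forall₂_congr fun i j => ?_
  simp_rw [Matrix.mul_apply, Matrix.transpose_apply, Finset.sum_mul]
  rw [Finset.sum_comm]
  simp_rw [mul_comm (radauMatrix k a₁ a₂ i _)]

/-- The moment of a double sum of monomials in one variable. -/
theorem integral_sum_sum_mul_pow {ι κ : Type*} [Fintype ι] [Fintype κ] (a b : ℝ)
    (c : ι → κ → ℝ) (f : ι → κ → ℝ → ℝ) (hf : ∀ i j, Continuous (f i j)) (n : ℕ) :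
    ∫ x in a..b, (∑ i, ∑ j, c i j * f i j x) * x ^ n =
      ∑ i, ∑ j, c i j * ∫ x in a..b, f i j x * x ^ n := by
  simp_rw [Finset.sum_mul, mul_assoc]
  rw [intervalIntegral.integral_finsetSum fun i _ =>
    Continuous.intervalIntegrable (by fun_prop) _ _]
  refine Finset.sum_congr rfl fun i _ => ?_
  rw [intervalIntegral.integral_finsetSum fun j _ =>
    Continuous.intervalIntegrable (by fun_prop) _ _]
  exact Finset.sum_congr rfl fun j _ => intervalIntegral.integral_const_mul _ _

theorem stmt9 (k : ℕ) (hk : 1 ≤ k) (a₁ a₂ b₁ b₂ : ℝ) (ha : a₁ < a₂) (hb : b₁ < b₂)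
    (z : ℝ → ℝ → ℝ)
    (hz : ContinuousOn (fun p : ℝ × ℝ => z p.1 p.2) (Set.Icc a₁ a₂ ×ˢ Set.Icc b₁ b₂)) :
    ∃! c : Fin (k+1) → Fin (k+1) → ℝ,
      (∀ m n : ℕ, m < k → n < k →
        (∫ x in a₁..a₂, ∫ y in b₁..b₂,
            (∑ m' : Fin (k+1), ∑ n' : Fin (k+1), c m' n' * x ^ (m' : ℕ) * y ^ (n' : ℕ)) * x ^ m * y ^ n) =
        ∫ x in a₁..a₂, ∫ y in b₁..b₂, z x y * x ^ m * y ^ n) ∧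
      (∀ n : ℕ, n < k →
        (∫ y in b₁..b₂,
            (∑ m' : Fin (k+1), ∑ n' : Fin (k+1), c m' n' * a₂ ^ (m' : ℕ) * y ^ (n' : ℕ)) * y ^ n) =
        ∫ y in b₁..b₂, z a₂ y * y ^ n) ∧
      (∀ m : ℕ, m < k →
        (∫ x in a₁..a₂,
            (∑ m' : Fin (k+1), ∑ n' : Fin (k+1), c m' n' * x ^ (m' : ℕ) * b₂ ^ (n' : ℕ)) * x ^ m) =
        ∫ x in a₁..a₂, z x b₂ * x ^ m) ∧
      (∑ m' : Fin (k+1), ∑ n' : Fin (k+1), c m' n' * a₂ ^ (m' : ℕ) * b₂ ^ (n' : ℕ)) = z a₂ b₂ := by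
  have hright : ∀ (c : Fin (k + 1) → Fin (k + 1) → ℝ) (x : ℝ) (n : ℕ),
      (∫ y in b₁..b₂, (∑ m', ∑ n', c m' n' * x ^ (m' : ℕ) * y ^ (n' : ℕ)) * y ^ n) =
        ∑ m', ∑ n', c m' n' * x ^ (m' : ℕ) * ∫ y in b₁..b₂, y ^ (n' : ℕ) * y ^ n :=
    fun c x n => integral_sum_sum_mul_pow b₁ b₂ (fun m' n' => c m' n' * x ^ (m' : ℕ))
      (fun _ n' y => y ^ (n' : ℕ)) (fun _ _ => by fun_prop) n
  have htop : ∀ (c : Fin (k + 1) → Fin (k + 1) → ℝ) (w : Fin (k + 1) → ℝ) (m : ℕ),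
      (∫ x in a₁..a₂, (∑ m', ∑ n', c m' n' * x ^ (m' : ℕ) * w n') * x ^ m) =
        ∑ m', ∑ n', c m' n' * (∫ x in a₁..a₂, x ^ (m' : ℕ) * x ^ m) * w n' := fun c w m => by
    simp_rw [mul_right_comm (c _ _) _ (w _)]
    exact integral_sum_sum_mul_pow a₁ a₂ (fun m' n' => c m' n' * w n')
      (fun m' _ x => x ^ (m' : ℕ)) (fun _ _ => by fun_prop) m
  have hvol : ∀ (c : Fin (k + 1) → Fin (k + 1) → ℝ) (m n : ℕ),
      (∫ x in a₁..a₂, ∫ y in b₁..b₂,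
        (∑ m', ∑ n', c m' n' * x ^ (m' : ℕ) * y ^ (n' : ℕ)) * x ^ m * y ^ n) =
        ∑ m', ∑ n', c m' n' * (∫ x in a₁..a₂, x ^ (m' : ℕ) * x ^ m) *
          ∫ y in b₁..b₂, y ^ (n' : ℕ) * y ^ n := fun c m n => by
    simp_rw [mul_right_comm _ (_ ^ m) (_ ^ n), intervalIntegral.integral_mul_const, hright]
    exact htop c (fun n' => ∫ y in b₁..b₂, y ^ (n' : ℕ) * y ^ n) m
  let D : Matrix (Fin (k + 1)) (Fin (k + 1)) ℝ := fun i j =>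
    if (i : ℕ) < k then
      if (j : ℕ) < k then ∫ x in a₁..a₂, ∫ y in b₁..b₂, z x y * x ^ (i : ℕ) * y ^ (j : ℕ)
      else ∫ x in a₁..a₂, z x b₂ * x ^ (i : ℕ)
    else
      if (j : ℕ) < k then ∫ y in b₁..b₂, z a₂ y * y ^ (j : ℕ) else z a₂ b₂
  refine (existsUnique_congr fun c => ?_).mpr (Matrix.existsUnique_mul_mul_eq
    (isUnit_radauMatrix ha k) ((Matrix.isUnit_transpose _).mpr (isUnit_radauMatrix hb k)) D)
  refine Iff.trans ?_ (radauMatrix_mul_mul_eq_iff k a₁ a₂ b₁ b₂ c D).symm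
  simp_rw [hvol, hright, htop, Fin.forall_fin_succ']
  simp only [radauMatrix, D, Fin.val_castSucc, Fin.val_last, Fin.is_lt, lt_irrefl, if_true,
    if_false, forall_and, Fin.forall_iff]
  grind
end

section
/- Consistency of the LDG scheme (Galerkin orthogonality): if u is a C² classical solution of −ε Δu + a₁ u_x + a₂ u_y + b u = f on Ω = (0,1)² with u = 0 on ∂Ω, and w = (u, ε u_x, ε u_y), then B(w; Z) = ∫_Ω f v for every Z = (v,s,r) ∈ V_N³; consequently, if W ∈ V_N³ satisfies B(W;Z) = ∫_Ω f v for all Z ∈ V_N³, then B(w − W; Z) = 0 for all Z ∈ V_N³. -/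
open MeasureTheory Real Set

/-- Admissibility of the data `k, N, ρ, ε`. -/
def MeshHyp (k N : ℕ) (ρ ε : ℝ) : Prop :=
  1 ≤ k ∧ (k : ℝ) + 2 ≤ ρ ∧ 8 ≤ N ∧ Even N ∧ 0 < ε ∧ ε ≤ (N : ℝ)⁻¹ ∧
    ρ * ε * Real.log (1/ε) ≤ 1/2

/-- Mixed partial derivative `∂_x^m ∂_y^n f`. -/
noncomputable def pd2 (m n : ℕ) (f : ℝ → ℝ → ℝ) (x y : ℝ) : ℝ :=
  iteratedDeriv m (fun t => iteratedDeriv n (f t) y) x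

/-- The solution decomposition `u = S + E21 + E12 + E22` with the layer bounds. -/
def SolDecomp (k : ℕ) (ε α₁ α₂ Cu : ℝ) (u S E21 E12 E22 : ℝ → ℝ → ℝ) : Prop :=
  ContDiff ℝ (k+2 : ℕ) (Function.uncurry u) ∧
  (∀ x y : ℝ, u x y = S x y + E21 x y + E12 x y + E22 x y) ∧
  ∀ m n : ℕ, m + n ≤ k + 2 → ∀ x ∈ Set.Icc (0:ℝ) 1, ∀ y ∈ Set.Icc (0:ℝ) 1,
    |pd2 m n S x y| ≤ Cu ∧
    |pd2 m n E21 x y| ≤ Cu * ε ^ (-(m : ℝ)) * Real.exp (-(α₁*(1-x))/ε) ∧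
    |pd2 m n E12 x y| ≤ Cu * ε ^ (-(n : ℝ)) * Real.exp (-(α₂*(1-y))/ε) ∧
    |pd2 m n E22 x y| ≤ Cu * ε ^ (-((m : ℝ)+(n : ℝ))) *
      Real.exp (-(α₁*(1-x)+α₂*(1-y))/ε)

/-- `g` is a tensor-product polynomial of degree `≤ k` in each variable. -/
def IsQk (k : ℕ) (g : ℝ → ℝ → ℝ) : Prop :=
  ∃ c : Fin (k+1) → Fin (k+1) → ℝ,
    ∀ x y : ℝ, g x y = ∑ m : Fin (k+1), ∑ n : Fin (k+1), c m n * x ^ (m : ℕ) * y ^ (n : ℕ)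

/-- Membership in the discontinuous finite element space `V_N` (cellwise representation):
a family of `Q^k` polynomials, one for each cell. -/
def IsVN (k : ℕ) (v : ℕ → ℕ → ℝ → ℝ → ℝ) : Prop := ∀ i j : ℕ, IsQk k (v i j)

/-- Defining conditions of the local Gauss-Radau projection `π⁻` of `z`
on the cell `(x0,x1) × (y0,y1)`. -/
def ProjPiMinus (k : ℕ) (x0 x1 y0 y1 : ℝ) (z g : ℝ → ℝ → ℝ) : Prop :=
  IsQk k g ∧
  (∀ m n : ℕ, m < k → n < k →
    (∫ x in x0..x1, ∫ y in y0..y1, (g x y - z x y) * x ^ m * y ^ n) = 0) ∧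
  (∀ n : ℕ, n < k → (∫ y in y0..y1, (g x1 y - z x1 y) * y ^ n) = 0) ∧
  (∀ m : ℕ, m < k → (∫ x in x0..x1, (g x y1 - z x y1) * x ^ m) = 0) ∧
  g x1 y1 = z x1 y1

/-- Defining conditions of the projection `π_x⁻`. -/
def ProjPiXMinus (k : ℕ) (x0 x1 y0 y1 : ℝ) (z g : ℝ → ℝ → ℝ) : Prop :=
  IsQk k g ∧
  (∀ m n : ℕ, m < k → n ≤ k →
    (∫ x in x0..x1, ∫ y in y0..y1, (g x y - z x y) * x ^ m * y ^ n) = 0) ∧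
  (∀ n : ℕ, n ≤ k → (∫ y in y0..y1, (g x1 y - z x1 y) * y ^ n) = 0)

/-- Defining conditions of the projection `π_y⁻`. -/
def ProjPiYMinus (k : ℕ) (x0 x1 y0 y1 : ℝ) (z g : ℝ → ℝ → ℝ) : Prop :=
  IsQk k g ∧
  (∀ m n : ℕ, m ≤ k → n < k →
    (∫ x in x0..x1, ∫ y in y0..y1, (g x y - z x y) * x ^ m * y ^ n) = 0) ∧
  (∀ m : ℕ, m ≤ k → (∫ x in x0..x1, (g x y1 - z x y1) * x ^ m) = 0)

/-- Defining conditions of the projection `π_x⁺`. -/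
def ProjPiXPlus (k : ℕ) (x0 x1 y0 y1 : ℝ) (z g : ℝ → ℝ → ℝ) : Prop :=
  IsQk k g ∧
  (∀ m n : ℕ, m < k → n ≤ k →
    (∫ x in x0..x1, ∫ y in y0..y1, (g x y - z x y) * x ^ m * y ^ n) = 0) ∧
  (∀ n : ℕ, n ≤ k → (∫ y in y0..y1, (g x0 y - z x0 y) * y ^ n) = 0)

/-- Defining conditions of the projection `π_y⁺`. -/
def ProjPiYPlus (k : ℕ) (x0 x1 y0 y1 : ℝ) (z g : ℝ → ℝ → ℝ) : Prop :=
  IsQk k g ∧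
  (∀ m n : ℕ, m ≤ k → n < k →
    (∫ x in x0..x1, ∫ y in y0..y1, (g x y - z x y) * x ^ m * y ^ n) = 0) ∧
  (∀ m : ℕ, m ≤ k → (∫ x in x0..x1, (g x y0 - z x y0) * x ^ m) = 0)

/-- `Pu` is a cellwise representation of the interpolant `𝒫⁻u`:
`π_x⁻u` on cells `K_{N/2,j}` with `j ≠ N/2`, `π_y⁻u` on cells `K_{i,N/2}` with `i ≠ N/2`,
and `π⁻u` on all other cells. -/
def IsPMinusInterp (k N : ℕ) (ρ ε : ℝ) (u : ℝ → ℝ → ℝ) (Pu : ℕ → ℕ → ℝ → ℝ → ℝ) : Prop :=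
  ∀ i j : ℕ, 1 ≤ i → i ≤ N → 1 ≤ j → j ≤ N →
    if i = N/2 ∧ j ≠ N/2 then
      ProjPiXMinus k (xpt ρ ε N (i-1)) (xpt ρ ε N i) (xpt ρ ε N (j-1)) (xpt ρ ε N j) u (Pu i j)
    else if j = N/2 ∧ i ≠ N/2 then
      ProjPiYMinus k (xpt ρ ε N (i-1)) (xpt ρ ε N i) (xpt ρ ε N (j-1)) (xpt ρ ε N j) u (Pu i j)
    else
      ProjPiMinus k (xpt ρ ε N (i-1)) (xpt ρ ε N i) (xpt ρ ε N (j-1)) (xpt ρ ε N j) u (Pu i j)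

/-- `Pp` is a cellwise representation of the interpolant `π_x⁺p`. -/
def IsPxPlusInterp (k N : ℕ) (ρ ε : ℝ) (p : ℝ → ℝ → ℝ) (Pp : ℕ → ℕ → ℝ → ℝ → ℝ) : Prop :=
  ∀ i j : ℕ, 1 ≤ i → i ≤ N → 1 ≤ j → j ≤ N →
    ProjPiXPlus k (xpt ρ ε N (i-1)) (xpt ρ ε N i) (xpt ρ ε N (j-1)) (xpt ρ ε N j) p (Pp i j)

/-- `Pq` is a cellwise representation of the interpolant `π_y⁺q`. -/
def IsPyPlusInterp (k N : ℕ) (ρ ε : ℝ) (q : ℝ → ℝ → ℝ) (Pq : ℕ → ℕ → ℝ → ℝ → ℝ) : Prop :=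
  ∀ i j : ℕ, 1 ≤ i → i ≤ N → 1 ≤ j → j ≤ N →
    ProjPiYPlus k (xpt ρ ε N (i-1)) (xpt ρ ε N i) (xpt ρ ε N (j-1)) (xpt ρ ε N j) q (Pq i j)

/-- Cell-by-cell integral over `Ω = (0,1)²`: the integrand on cell `K_{ij}` is `F i j`. -/
noncomputable def cellInt (ρ ε : ℝ) (N : ℕ) (F : ℕ → ℕ → ℝ → ℝ → ℝ) : ℝ :=
  ∑ i ∈ Finset.Icc 1 N, ∑ j ∈ Finset.Icc 1 N,
    ∫ x in (xpt ρ ε N (i-1))..(xpt ρ ε N i),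
      ∫ y in (xpt ρ ε N (j-1))..(xpt ρ ε N j), F i j x y

/-- Jump `[[v]]_{i,y}` across the vertical mesh line `x = x_i`, in row `j`. -/
noncomputable def jumpX (ρ ε : ℝ) (N : ℕ) (v : ℕ → ℕ → ℝ → ℝ → ℝ) (i j : ℕ) (y : ℝ) : ℝ :=
  if i = 0 then v 1 j (xpt ρ ε N 0) y
  else if i = N then -(v N j (xpt ρ ε N N) y)
  else v (i+1) j (xpt ρ ε N i) y - v i j (xpt ρ ε N i) y

/-- Jump `[[v]]_{x,j}` across the horizontal mesh line `y = y_j`, in column `i`. -/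
noncomputable def jumpY (ρ ε : ℝ) (N : ℕ) (v : ℕ → ℕ → ℝ → ℝ → ℝ) (i j : ℕ) (x : ℝ) : ℝ :=
  if j = 0 then v i 1 x (xpt ρ ε N 0)
  else if j = N then -(v i N x (xpt ρ ε N N))
  else v i (j+1) x (xpt ρ ε N j) - v i j x (xpt ρ ε N j)

/-- The LDG bilinear form `B(W;Z) = 𝓑₁ + 𝓑₂ + 𝓑₃ + 𝓑₄` on cellwise-represented triples
`W = (U,P,Q)` and `Z = (v,s,r)`. -/
noncomputable def Bform (ρ ε : ℝ) (N : ℕ) (a₁ a₂ b : ℝ → ℝ → ℝ) (lam₁ lam₂ : ℝ)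
    (U P Q v s r : ℕ → ℕ → ℝ → ℝ → ℝ) : ℝ :=
  -- 𝓑₁
  cellInt ρ ε N (fun i j x y =>
      (b x y - (deriv (fun t => a₁ t y) x + deriv (fun t => a₂ x t) y)) * U i j x y * v i j x y)
  + ε⁻¹ * cellInt ρ ε N (fun i j x y => P i j x y * s i j x y)
  + ε⁻¹ * cellInt ρ ε N (fun i j x y => Q i j x y * r i j x y)
  -- 𝓑₂
  + cellInt ρ ε N (fun i j x y => U i j x y * deriv (fun t => s i j t y) x)
  + (∑ i ∈ Finset.Icc 1 (N-1), ∑ j ∈ Finset.Icc 1 N,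
      ∫ y in (xpt ρ ε N (j-1))..(xpt ρ ε N j),
        U i j (xpt ρ ε N i) y * jumpX ρ ε N s i j y)
  + cellInt ρ ε N (fun i j x y => U i j x y * deriv (fun t => r i j x t) y)
  + (∑ i ∈ Finset.Icc 1 N, ∑ j ∈ Finset.Icc 1 (N-1),
      ∫ x in (xpt ρ ε N (i-1))..(xpt ρ ε N i),
        U i j x (xpt ρ ε N j) * jumpY ρ ε N r i j x)
  -- 𝓑₃
  + cellInt ρ ε N (fun i j x y => P i j x y * deriv (fun t => v i j t y) x)
  + (∑ j ∈ Finset.Icc 1 N,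
      ((∑ i ∈ Finset.range N,
        ∫ y in (xpt ρ ε N (j-1))..(xpt ρ ε N j),
          P (i+1) j (xpt ρ ε N i) y * jumpX ρ ε N v i j y)
       - ∫ y in (xpt ρ ε N (j-1))..(xpt ρ ε N j),
          P N j (xpt ρ ε N N) y * v N j (xpt ρ ε N N) y))
  + cellInt ρ ε N (fun i j x y => Q i j x y * deriv (fun t => v i j x t) y)
  + (∑ i ∈ Finset.Icc 1 N,
      ((∑ j ∈ Finset.range N,
        ∫ x in (xpt ρ ε N (i-1))..(xpt ρ ε N i),
          Q i (j+1) x (xpt ρ ε N j) * jumpY ρ ε N v i j x)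
       - ∫ x in (xpt ρ ε N (i-1))..(xpt ρ ε N i),
          Q i N x (xpt ρ ε N N) * v i N x (xpt ρ ε N N)))
  -- 𝓑₄
  - cellInt ρ ε N (fun i j x y => a₁ x y * U i j x y * deriv (fun t => v i j t y) x)
  - (∑ j ∈ Finset.Icc 1 N,
      ((∑ i ∈ Finset.Icc 1 N,
        ∫ y in (xpt ρ ε N (j-1))..(xpt ρ ε N j),
          a₁ (xpt ρ ε N i) y * U i j (xpt ρ ε N i) y * jumpX ρ ε N v i j y)
       - lam₁ * ∫ y in (xpt ρ ε N (j-1))..(xpt ρ ε N j),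
          U N j (xpt ρ ε N N) y * v N j (xpt ρ ε N N) y))
  - cellInt ρ ε N (fun i j x y => a₂ x y * U i j x y * deriv (fun t => v i j x t) y)
  - (∑ i ∈ Finset.Icc 1 N,
      ((∑ j ∈ Finset.Icc 1 N,
        ∫ x in (xpt ρ ε N (i-1))..(xpt ρ ε N i),
          a₂ x (xpt ρ ε N j) * U i j x (xpt ρ ε N j) * jumpY ρ ε N v i j x)
       - lam₂ * ∫ x in (xpt ρ ε N (i-1))..(xpt ρ ε N i),
          U i N x (xpt ρ ε N N) * v i N x (xpt ρ ε N N)))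

/-- The square of the energy norm `|||Z|||_E²` of a cellwise-represented triple `Z = (v,s,r)`. -/
noncomputable def energySq (ρ ε : ℝ) (N : ℕ) (a₁ a₂ b : ℝ → ℝ → ℝ) (lam₁ lam₂ : ℝ)
    (v s r : ℕ → ℕ → ℝ → ℝ → ℝ) : ℝ :=
  ε⁻¹ * cellInt ρ ε N (fun i j x y => (s i j x y) ^ 2)
  + ε⁻¹ * cellInt ρ ε N (fun i j x y => (r i j x y) ^ 2)
  + cellInt ρ ε N (fun i j x y =>
      (b x y - (1/2) * (deriv (fun t => a₁ t y) x + deriv (fun t => a₂ x t) y)) * (v i j x y) ^ 2)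
  + (∑ j ∈ Finset.Icc 1 N,
      ((∑ i ∈ Finset.range N, (1/2) *
          ∫ y in (xpt ρ ε N (j-1))..(xpt ρ ε N j),
            a₁ (xpt ρ ε N i) y * (jumpX ρ ε N v i j y) ^ 2)
       + ∫ y in (xpt ρ ε N (j-1))..(xpt ρ ε N j),
          ((1/2) * a₁ 1 y + lam₁) * (jumpX ρ ε N v N j y) ^ 2))
  + (∑ i ∈ Finset.Icc 1 N,
      ((∑ j ∈ Finset.range N, (1/2) *
          ∫ x in (xpt ρ ε N (i-1))..(xpt ρ ε N i),
            a₂ x (xpt ρ ε N j) * (jumpY ρ ε N v i j x) ^ 2)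
       + ∫ x in (xpt ρ ε N (i-1))..(xpt ρ ε N i),
          ((1/2) * a₂ x 1 + lam₂) * (jumpY ρ ε N v i N x) ^ 2))

/-- The energy norm `|||Z|||_E`. -/
noncomputable def energyNorm (ρ ε : ℝ) (N : ℕ) (a₁ a₂ b : ℝ → ℝ → ℝ) (lam₁ lam₂ : ℝ)
    (v s r : ℕ → ℕ → ℝ → ℝ → ℝ) : ℝ :=
  Real.sqrt (energySq ρ ε N a₁ a₂ b lam₁ lam₂ v s r)

/-- Hypotheses on the coefficients: smoothness, positivity of `a₁, a₂`, and
`b - (1/2)(∂_x a₁ + ∂_y a₂) ≥ β > 0` on `[0,1]²`. -/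
def CoeffHyp (a₁ a₂ b : ℝ → ℝ → ℝ) (β : ℝ) : Prop :=
  ContDiff ℝ (⊤ : ℕ∞) (Function.uncurry a₁) ∧ ContDiff ℝ (⊤ : ℕ∞) (Function.uncurry a₂) ∧
  ContDiff ℝ (⊤ : ℕ∞) (Function.uncurry b) ∧ 0 < β ∧
  ∀ x ∈ Set.Icc (0:ℝ) 1, ∀ y ∈ Set.Icc (0:ℝ) 1,
    0 < a₁ x y ∧ 0 < a₂ x y ∧
    β ≤ b x y - (1/2) * (deriv (fun t => a₁ t y) x + deriv (fun t => a₂ x t) y)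

/-! ### Mesh points -/

theorem xpt_zero (ρ ε : ℝ) (N : ℕ) : xpt ρ ε N 0 = 0 := by
  simp [xpt, phiB]

theorem xpt_self {k N : ℕ} {ρ ε : ℝ} (h : MeshHyp k N ρ ε) : xpt ρ ε N N = 1 := by
  obtain ⟨-, -, hN, -⟩ := h
  have : (N : ℝ) ≠ 0 := by positivity
  simp only [xpt, phiB, div_self this]
  norm_num

theorem xpt_mem_Icc {k N : ℕ} {ρ ε : ℝ} (h : MeshHyp k N ρ ε) {i : ℕ} (hi : i ≤ N) :
    xpt ρ ε N i ∈ Icc (0 : ℝ) 1 := by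
  obtain ⟨-, hρ, hN, -, hε, hεN, hle⟩ := h
  have hNR : (8 : ℝ) ≤ N := by exact_mod_cast hN
  have hN0 : (0 : ℝ) < N := by linarith
  have hd0 : 0 ≤ (i : ℝ) / N := by positivity
  have hd1 : (i : ℝ) / N ≤ 1 := by
    rw [div_le_one hN0]
    exact_mod_cast hi
  have hε8 : ε ≤ 1 / 8 := by
    have := inv_anti₀ (by norm_num : (0 : ℝ) < 8) hNR
    linarith
  have hρ0 : 0 < ρ := by
    have : (0 : ℝ) ≤ k := Nat.cast_nonneg k
    linarith
  have hlog : 0 ≤ ρ * ε * Real.log (1 / ε) := by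
    have : 0 ≤ Real.log (1 / ε) := Real.log_nonneg (by rw [le_div_iff₀ hε]; linarith)
    positivity
  unfold xpt
  generalize (i : ℝ) / N = d at hd0 hd1 ⊢
  unfold phiB
  split_ifs with h
  · constructor
    · have : 0 ≤ 1 - ρ * ε * Real.log (1 / ε) := by linarith
      positivity
    · nlinarith
  · push Not at h
    set t := 1 - 2 * (1 - ε) * (1 - d) with ht
    have ht1 : ε ≤ t := by rw [ht]; nlinarith
    have ht2 : t ≤ 1 := by rw [ht]; nlinarith
    have hl1 : Real.log t ≤ 0 := Real.log_nonpos (by linarith) ht2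
    have hl2 : Real.log ε ≤ Real.log t := Real.log_le_log hε ht1
    have hl3 : Real.log (1 / ε) = -Real.log ε := by simp
    rw [hl3] at hle
    have hρε : 0 < ρ * ε := by positivity
    constructor <;> nlinarith

theorem uIcc_xpt_subset {k N : ℕ} {ρ ε : ℝ} (h : MeshHyp k N ρ ε) {i : ℕ}
    (hi : i ∈ Finset.Icc 1 N) :
    uIcc (xpt ρ ε N (i - 1)) (xpt ρ ε N i) ⊆ Icc (0 : ℝ) 1 := by
  rw [Finset.mem_Icc] at hi
  exact ordConnected_Icc.uIcc_subset (xpt_mem_Icc h (by omega)) (xpt_mem_Icc h hi.2)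

/-! ### Smoothness of partial derivatives -/

theorem contDiff_deriv_left {n : WithTop ℕ∞} {g : ℝ → ℝ → ℝ}
    (hg : ContDiff ℝ (n + 1) (Function.uncurry g)) :
    ContDiff ℝ n (Function.uncurry fun x y => deriv (fun t => g t y) x) := by
  have key : (Function.uncurry fun x y => deriv (fun t => g t y) x) =
      fun p : ℝ × ℝ => fderiv ℝ (Function.uncurry g) p (1, 0) := by
    ext ⟨x, y⟩
    have h1 : HasFDerivAt (Function.uncurry g) (fderiv ℝ (Function.uncurry g) (x, y)) (x, y) :=
      (hg.differentiable (by simp) (x, y)).hasFDerivAt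
    have h2 : HasDerivAt (fun t : ℝ => (t, y)) ((1 : ℝ), (0 : ℝ)) x :=
      (hasDerivAt_id x).prodMk (hasDerivAt_const x y)
    exact (h1.comp_hasDerivAt x h2).deriv
  rw [key]
  exact (hg.fderiv_right le_rfl).clm_apply contDiff_const

theorem ContDiff.uncurry_flip {n : WithTop ℕ∞} {g : ℝ → ℝ → ℝ}
    (hg : ContDiff ℝ n (Function.uncurry g)) :
    ContDiff ℝ n (Function.uncurry fun x y => g y x) :=
  hg.comp (contDiff_snd.prodMk contDiff_fst)

theorem contDiff_deriv_right {n : WithTop ℕ∞} {g : ℝ → ℝ → ℝ}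
    (hg : ContDiff ℝ (n + 1) (Function.uncurry g)) :
    ContDiff ℝ n (Function.uncurry fun x y => deriv (fun t => g x t) y) :=
  (contDiff_deriv_left hg.uncurry_flip).uncurry_flip

theorem ContDiff.uncurry_mul {n : WithTop ℕ∞} {g h : ℝ → ℝ → ℝ}
    (hg : ContDiff ℝ n (Function.uncurry g)) (hh : ContDiff ℝ n (Function.uncurry h)) :
    ContDiff ℝ n (Function.uncurry fun x y => g x y * h x y) :=
  ContDiff.mul hg hh

theorem IsQk.contDiff {k : ℕ} {g : ℝ → ℝ → ℝ} (hg : IsQk k g) {n : WithTop ℕ∞} :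
    ContDiff ℝ n (Function.uncurry g) := by
  obtain ⟨c, hc⟩ := hg
  have : Function.uncurry g = fun p : ℝ × ℝ =>
      ∑ m : Fin (k+1), ∑ n : Fin (k+1), c m n * p.1 ^ (m : ℕ) * p.2 ^ (n : ℕ) := by
    ext ⟨x, y⟩
    exact hc x y
  rw [this]
  fun_prop

/-! ### Linearity and symmetry of the cellwise integral -/

theorem continuous_integral_right {F : ℝ → ℝ → ℝ} (hF : Continuous (Function.uncurry F))
    (c d : ℝ) : Continuous fun x => ∫ y in c..d, F x y :=
  intervalIntegral.continuous_parametric_intervalIntegral_of_continuous' hF c d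

theorem Continuous.uncurry_add {F G : ℝ → ℝ → ℝ} (hF : Continuous (Function.uncurry F))
    (hG : Continuous (Function.uncurry G)) :
    Continuous (Function.uncurry fun x y => F x y + G x y) :=
  hF.add hG

theorem Continuous.uncurry_sub {F G : ℝ → ℝ → ℝ} (hF : Continuous (Function.uncurry F))
    (hG : Continuous (Function.uncurry G)) :
    Continuous (Function.uncurry fun x y => F x y - G x y) :=
  hF.sub hG

theorem integral_integral_sub {F G : ℝ → ℝ → ℝ} (hF : Continuous (Function.uncurry F))
    (hG : Continuous (Function.uncurry G)) (a b c d : ℝ) :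
    (∫ x in a..b, ∫ y in c..d, F x y - G x y) =
      (∫ x in a..b, ∫ y in c..d, F x y) - ∫ x in a..b, ∫ y in c..d, G x y := by
  rw [← intervalIntegral.integral_sub
    ((continuous_integral_right hF c d).intervalIntegrable _ _)
    ((continuous_integral_right hG c d).intervalIntegrable _ _)]
  refine intervalIntegral.integral_congr fun x _ => ?_
  exact intervalIntegral.integral_sub ((hF.uncurry_left x).intervalIntegrable _ _)
    ((hG.uncurry_left x).intervalIntegrable _ _)

theorem integral_integral_swap_of_continuous {F : ℝ → ℝ → ℝ}
    (hF : Continuous (Function.uncurry F)) (a b c d : ℝ) :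
    (∫ x in a..b, ∫ y in c..d, F x y) = ∫ y in c..d, ∫ x in a..b, F x y := by
  refine intervalIntegral_intervalIntegral_swap ?_
  exact (hF.continuousOn.integrableOn_compact (isCompact_uIcc.prod isCompact_uIcc)).mono_set
    (prod_mono uIoc_subset_uIcc uIoc_subset_uIcc)

section cellInt

variable {ρ ε : ℝ} {N : ℕ} {F G : ℕ → ℕ → ℝ → ℝ → ℝ}

theorem cellInt_sub (hF : ∀ i j, Continuous (Function.uncurry (F i j)))
    (hG : ∀ i j, Continuous (Function.uncurry (G i j))) :
    cellInt ρ ε N (fun i j x y => F i j x y - G i j x y) =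
      cellInt ρ ε N F - cellInt ρ ε N G := by
  simp only [cellInt, integral_integral_sub (hF _ _) (hG _ _), Finset.sum_sub_distrib]

theorem cellInt_neg : cellInt ρ ε N (fun i j x y => -F i j x y) = -cellInt ρ ε N F := by
  simp only [cellInt, intervalIntegral.integral_neg, Finset.sum_neg_distrib]

theorem cellInt_add (hF : ∀ i j, Continuous (Function.uncurry (F i j)))
    (hG : ∀ i j, Continuous (Function.uncurry (G i j))) :
    cellInt ρ ε N (fun i j x y => F i j x y + G i j x y) =
      cellInt ρ ε N F + cellInt ρ ε N G := by
  have hG' : ∀ i j, Continuous (Function.uncurry fun x y => -G i j x y) :=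
    fun i j => (hG i j).neg
  have := cellInt_sub (ρ := ρ) (ε := ε) (N := N) hF (G := fun i j x y => -G i j x y) hG'
  simpa only [cellInt_neg, sub_neg_eq_add] using this

theorem cellInt_const_mul (c : ℝ) :
    cellInt ρ ε N (fun i j x y => c * F i j x y) = c * cellInt ρ ε N F := by
  simp only [cellInt, intervalIntegral.integral_const_mul, Finset.mul_sum]

theorem cellInt_flip (hF : ∀ i j, Continuous (Function.uncurry (F i j))) :
    cellInt ρ ε N (fun i j x y => F j i y x) = cellInt ρ ε N F := by
  unfold cellInt
  rw [Finset.sum_comm]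
  refine Finset.sum_congr rfl fun i _ => Finset.sum_congr rfl fun j _ => ?_
  exact (integral_integral_swap_of_continuous (hF i j) _ _ _ _).symm

theorem cellInt_congr {k : ℕ} (h : MeshHyp k N ρ ε)
    (hFG : ∀ i j, ∀ x ∈ Icc (0 : ℝ) 1, ∀ y ∈ Icc (0 : ℝ) 1, F i j x y = G i j x y) :
    cellInt ρ ε N F = cellInt ρ ε N G := by
  unfold cellInt
  refine Finset.sum_congr rfl fun i hi => Finset.sum_congr rfl fun j hj => ?_
  refine intervalIntegral.integral_congr fun x hx => ?_
  refine intervalIntegral.integral_congr fun y hy => ?_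
  exact hFG i j x (uIcc_xpt_subset h hi hx) y (uIcc_xpt_subset h hj hy)

end cellInt

/-! ### Integration by parts on the mesh -/

theorem sum_Icc_one_eq_sum_range {M : Type*} [AddCommMonoid M] (N : ℕ) (f : ℕ → M) :
    ∑ i ∈ Finset.Icc 1 N, f i = ∑ i ∈ Finset.range N, f (i + 1) := by
  rw [Finset.range_eq_Ico, Finset.sum_Ico_add' f 0 N 1]
  rfl

theorem continuous_jumpX {ρ ε : ℝ} {N : ℕ} {v : ℕ → ℕ → ℝ → ℝ → ℝ}
    (hv : ∀ i j, Continuous (Function.uncurry (v i j))) (i j : ℕ) :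
    Continuous (jumpX ρ ε N v i j) := by
  have h := fun i j x => (hv i j).uncurry_left x
  unfold jumpX
  split_ifs <;> fun_prop

theorem continuous_jumpY {ρ ε : ℝ} {N : ℕ} {v : ℕ → ℕ → ℝ → ℝ → ℝ}
    (hv : ∀ i j, Continuous (Function.uncurry (v i j))) (i j : ℕ) :
    Continuous (jumpY ρ ε N v i j) :=
  continuous_jumpX (v := fun i j x y => v j i y x)
    (fun i j => (hv j i).comp continuous_swap) j i

theorem integral_integral_mul_deriv {g w : ℝ → ℝ → ℝ}
    (hg : ContDiff ℝ 1 (Function.uncurry g)) (hw : ContDiff ℝ 1 (Function.uncurry w))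
    (a b c d : ℝ) :
    (∫ x in a..b, ∫ y in c..d, g x y * deriv (fun t => w t y) x) =
      (∫ y in c..d, g b y * w b y) - (∫ y in c..d, g a y * w a y) -
        ∫ x in a..b, ∫ y in c..d, deriv (fun t => g t y) x * w x y := by
  have hg' := (contDiff_deriv_left (n := 0) hg).continuous
  have hw' := (contDiff_deriv_left (n := 0) hw).continuous
  have hgc := hg.continuous
  have hwc := hw.continuous
  have hgx := fun x => hgc.uncurry_left x
  have hwx := fun x => hwc.uncurry_left x
  have h2 : Continuous (Function.uncurry fun x y => deriv (fun t => g t y) x * w x y) :=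
    hg'.mul hwc
  have h1 : Continuous (Function.uncurry fun x y => g x y * deriv (fun t => w t y) x) :=
    hgc.mul hw'
  have h3 : Continuous (Function.uncurry fun y x => deriv (fun t => g t y) x * w x y) :=
    h2.comp continuous_swap
  rw [integral_integral_swap_of_continuous h1,
    integral_integral_swap_of_continuous h2,
    ← intervalIntegral.integral_sub, ← intervalIntegral.integral_sub]
  · refine intervalIntegral.integral_congr fun y _ => ?_
    refine intervalIntegral.integral_mul_deriv_eq_deriv_mul (u := fun x => g x y)
      (v := fun x => w x y) (fun x _ => ?_) (fun x _ => ?_)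
      ((hg'.uncurry_right y).intervalIntegrable _ _) ((hw'.uncurry_right y).intervalIntegrable _ _)
    · exact ((hg.comp (contDiff_prodMk_left y)).differentiable one_ne_zero x).hasDerivAt
    · exact ((hw.comp (contDiff_prodMk_left y)).differentiable one_ne_zero x).hasDerivAt
  · exact Continuous.intervalIntegrable (by fun_prop) _ _
  · exact (continuous_integral_right h3 a b).intervalIntegrable _ _
  · exact Continuous.intervalIntegrable (by fun_prop) _ _
  · exact Continuous.intervalIntegrable (by fun_prop) _ _

theorem sum_integral_mul_jumpX {ρ ε : ℝ} {N : ℕ} (hN : N ≠ 0) {g : ℝ → ℝ → ℝ}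
    {v : ℕ → ℕ → ℝ → ℝ → ℝ} (hg : Continuous (Function.uncurry g))
    (hv : ∀ i j, Continuous (Function.uncurry (v i j))) (j : ℕ) (c d : ℝ) :
    ∑ i ∈ Finset.range (N + 1), ∫ y in c..d, g (xpt ρ ε N i) y * jumpX ρ ε N v i j y =
      ∑ i ∈ Finset.range N, ((∫ y in c..d, g (xpt ρ ε N i) y * v (i + 1) j (xpt ρ ε N i) y) -
        ∫ y in c..d, g (xpt ρ ε N (i + 1)) y * v (i + 1) j (xpt ρ ε N (i + 1)) y) := by
  have hgx := fun x => hg.uncurry_left x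
  have hvx := fun i j x => (hv i j).uncurry_left x
  set A : ℕ → ℝ := fun i => ∫ y in c..d, g (xpt ρ ε N i) y * v i j (xpt ρ ε N i) y with hA
  set B : ℕ → ℝ := fun i => ∫ y in c..d, g (xpt ρ ε N i) y * v (i + 1) j (xpt ρ ε N i) y with hB
  have key : ∀ i ∈ Finset.range (N + 1),
      (∫ y in c..d, g (xpt ρ ε N i) y * jumpX ρ ε N v i j y) =
        (if i < N then B i else 0) - (if 0 < i then A i else 0) := by
    intro i hi
    rw [Finset.mem_range] at hi
    rcases Nat.eq_zero_or_pos i with rfl | hi0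
    · simp [jumpX, hB, Nat.pos_of_ne_zero hN]
    · rcases (Nat.lt_succ_iff.mp hi).lt_or_eq with hiN | rfl
      · simp only [jumpX, hi0.ne', hiN.ne, hi0, hiN, if_true, if_false, mul_sub, hA, hB]
        exact intervalIntegral.integral_sub (Continuous.intervalIntegrable (by fun_prop) _ _)
          (Continuous.intervalIntegrable (by fun_prop) _ _)
      · simp [jumpX, hi0.ne', hi0, hA]
  rw [Finset.sum_congr rfl key, Finset.sum_sub_distrib, Finset.sum_sub_distrib,
    Finset.sum_range_succ, Finset.sum_range_succ' (fun i => if 0 < i then A i else 0)]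
  simp only [lt_irrefl, if_false, add_zero, Nat.succ_pos, if_true]
  congr 1
  exact Finset.sum_congr rfl fun i hi => if_pos (Finset.mem_range.mp hi)

theorem cellInt_mul_deriv_left {ρ ε : ℝ} {N : ℕ} (hN : N ≠ 0) {g : ℝ → ℝ → ℝ}
    {v : ℕ → ℕ → ℝ → ℝ → ℝ} (hg : ContDiff ℝ 1 (Function.uncurry g))
    (hv : ∀ i j, ContDiff ℝ 1 (Function.uncurry (v i j))) :
    cellInt ρ ε N (fun i j x y => g x y * deriv (fun t => v i j t y) x) =
      -cellInt ρ ε N (fun i j x y => deriv (fun t => g t y) x * v i j x y) -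
        ∑ j ∈ Finset.Icc 1 N, ∑ i ∈ Finset.range (N + 1),
          ∫ y in (xpt ρ ε N (j-1))..(xpt ρ ε N j),
            g (xpt ρ ε N i) y * jumpX ρ ε N v i j y := by
  simp only [sum_integral_mul_jumpX hN hg.continuous fun i j => (hv i j).continuous]
  unfold cellInt
  rw [Finset.sum_comm, Finset.sum_comm (t := Finset.Icc 1 N) (s := Finset.Icc 1 N)
    (f := fun i j => ∫ x in (xpt ρ ε N (i-1))..(xpt ρ ε N i),
      ∫ y in (xpt ρ ε N (j-1))..(xpt ρ ε N j), deriv (fun t => g t y) x * v i j x y),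
    ← Finset.sum_neg_distrib, ← Finset.sum_sub_distrib]
  refine Finset.sum_congr rfl fun j _ => ?_
  rw [sum_Icc_one_eq_sum_range, sum_Icc_one_eq_sum_range, ← Finset.sum_neg_distrib,
    ← Finset.sum_sub_distrib]
  refine Finset.sum_congr rfl fun i _ => ?_
  rw [integral_integral_mul_deriv hg (hv _ _), Nat.add_sub_cancel]
  ring

theorem cellInt_mul_deriv_right {ρ ε : ℝ} {N : ℕ} (hN : N ≠ 0) {g : ℝ → ℝ → ℝ}
    {v : ℕ → ℕ → ℝ → ℝ → ℝ} (hg : ContDiff ℝ 1 (Function.uncurry g))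
    (hv : ∀ i j, ContDiff ℝ 1 (Function.uncurry (v i j))) :
    cellInt ρ ε N (fun i j x y => g x y * deriv (fun t => v i j x t) y) =
      -cellInt ρ ε N (fun i j x y => deriv (fun t => g x t) y * v i j x y) -
        ∑ i ∈ Finset.Icc 1 N, ∑ j ∈ Finset.range (N + 1),
          ∫ x in (xpt ρ ε N (i-1))..(xpt ρ ε N i),
            g x (xpt ρ ε N j) * jumpY ρ ε N v i j x := by
  have h := cellInt_mul_deriv_left (ρ := ρ) (ε := ε) hN hg.uncurry_flip
    (v := fun i j x y => v j i y x) fun i j => (hv j i).uncurry_flip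
  rw [cellInt_flip (F := fun i j x y => g x y * deriv (fun t => v i j x t) y),
    cellInt_flip (F := fun i j x y => deriv (fun t => g x t) y * v i j x y)] at h
  · exact h
  · exact fun i j => ((contDiff_deriv_right (n := 0) hg).continuous.mul (hv i j).continuous)
  · exact fun i j => hg.continuous.mul (contDiff_deriv_right (n := 0) (hv i j)).continuous

theorem cellInt_deriv_left_add_interior {k N : ℕ} {ρ ε : ℝ} (h : MeshHyp k N ρ ε)
    {g : ℝ → ℝ → ℝ} {s : ℕ → ℕ → ℝ → ℝ → ℝ} (hg : ContDiff ℝ 1 (Function.uncurry g))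
    (hs : ∀ i j, ContDiff ℝ 1 (Function.uncurry (s i j)))
    (h0 : ∀ y ∈ Icc (0 : ℝ) 1, g 0 y = 0) (h1 : ∀ y ∈ Icc (0 : ℝ) 1, g 1 y = 0) :
    cellInt ρ ε N (fun i j x y => g x y * deriv (fun t => s i j t y) x) +
        (∑ i ∈ Finset.Icc 1 (N-1), ∑ j ∈ Finset.Icc 1 N,
          ∫ y in (xpt ρ ε N (j-1))..(xpt ρ ε N j),
            g (xpt ρ ε N i) y * jumpX ρ ε N s i j y) =
      -cellInt ρ ε N (fun i j x y => deriv (fun t => g t y) x * s i j x y) := by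
  obtain ⟨M, rfl⟩ : ∃ M, N = M + 1 := ⟨N - 1, by have := h.2.2.1; omega⟩
  rw [cellInt_mul_deriv_left M.add_one_ne_zero hg hs,
    Finset.sum_comm (s := Finset.Icc 1 (M + 1 - 1)), sub_add_eq_add_sub,
    add_sub_assoc, ← Finset.sum_sub_distrib, Finset.sum_eq_zero, add_zero]
  intro j hj
  have e0 : (∫ y in (xpt ρ ε (M + 1) (j-1))..(xpt ρ ε (M + 1) j),
      g (xpt ρ ε (M + 1) 0) y * jumpX ρ ε (M + 1) s 0 j y) = 0 := by
    refine intervalIntegral.integral_zero_ae (.of_forall fun y hy => ?_)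
    rw [xpt_zero, h0 y (uIcc_xpt_subset h hj (uIoc_subset_uIcc hy)), zero_mul]
  have e1 : (∫ y in (xpt ρ ε (M + 1) (j-1))..(xpt ρ ε (M + 1) j),
      g (xpt ρ ε (M + 1) (M + 1)) y * jumpX ρ ε (M + 1) s (M + 1) j y) = 0 := by
    refine intervalIntegral.integral_zero_ae (.of_forall fun y hy => ?_)
    rw [xpt_self h, h1 y (uIcc_xpt_subset h hj (uIoc_subset_uIcc hy)), zero_mul]
  rw [Finset.sum_range_succ, Finset.sum_range_succ', Nat.add_sub_cancel,
    sum_Icc_one_eq_sum_range, e0, e1, add_zero, add_zero, sub_self]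

theorem cellInt_deriv_right_add_interior {k N : ℕ} {ρ ε : ℝ} (h : MeshHyp k N ρ ε)
    {g : ℝ → ℝ → ℝ} {r : ℕ → ℕ → ℝ → ℝ → ℝ} (hg : ContDiff ℝ 1 (Function.uncurry g))
    (hr : ∀ i j, ContDiff ℝ 1 (Function.uncurry (r i j)))
    (h0 : ∀ x ∈ Icc (0 : ℝ) 1, g x 0 = 0) (h1 : ∀ x ∈ Icc (0 : ℝ) 1, g x 1 = 0) :
    cellInt ρ ε N (fun i j x y => g x y * deriv (fun t => r i j x t) y) +
        (∑ i ∈ Finset.Icc 1 N, ∑ j ∈ Finset.Icc 1 (N-1),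
          ∫ x in (xpt ρ ε N (i-1))..(xpt ρ ε N i),
            g x (xpt ρ ε N j) * jumpY ρ ε N r i j x) =
      -cellInt ρ ε N (fun i j x y => deriv (fun t => g x t) y * r i j x y) := by
  have key := cellInt_deriv_left_add_interior h hg.uncurry_flip
    (s := fun i j x y => r j i y x) (fun i j => (hr j i).uncurry_flip) h0 h1
  rw [cellInt_flip (F := fun i j x y => g x y * deriv (fun t => r i j x t) y),
    cellInt_flip (F := fun i j x y => deriv (fun t => g x t) y * r i j x y),
    Finset.sum_comm] at key
  · exact key
  · exact fun i j => ((contDiff_deriv_right (n := 0) hg).continuous.mul (hr i j).continuous)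
  · exact fun i j => hg.continuous.mul (contDiff_deriv_right (n := 0) (hr i j)).continuous

theorem cellInt_deriv_left_add_all {N : ℕ} {ρ ε : ℝ} (hN : N ≠ 0)
    {g : ℝ → ℝ → ℝ} {v : ℕ → ℕ → ℝ → ℝ → ℝ} (hg : ContDiff ℝ 1 (Function.uncurry g))
    (hv : ∀ i j, ContDiff ℝ 1 (Function.uncurry (v i j))) :
    cellInt ρ ε N (fun i j x y => g x y * deriv (fun t => v i j t y) x) +
        (∑ j ∈ Finset.Icc 1 N,
          ((∑ i ∈ Finset.range N,
            ∫ y in (xpt ρ ε N (j-1))..(xpt ρ ε N j),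
              g (xpt ρ ε N i) y * jumpX ρ ε N v i j y)
          - ∫ y in (xpt ρ ε N (j-1))..(xpt ρ ε N j),
              g (xpt ρ ε N N) y * v N j (xpt ρ ε N N) y)) =
      -cellInt ρ ε N (fun i j x y => deriv (fun t => g t y) x * v i j x y) := by
  rw [cellInt_mul_deriv_left hN hg hv, sub_add_eq_add_sub,
    add_sub_assoc, ← Finset.sum_sub_distrib, Finset.sum_eq_zero, add_zero]
  intro j _
  have hjump : ∀ y, jumpX ρ ε N v N j y = -v N j (xpt ρ ε N N) y := by simp [jumpX, hN]
  simp only [Finset.sum_range_succ, hjump, mul_neg, intervalIntegral.integral_neg]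
  ring

theorem cellInt_deriv_right_add_all {N : ℕ} {ρ ε : ℝ} (hN : N ≠ 0)
    {g : ℝ → ℝ → ℝ} {v : ℕ → ℕ → ℝ → ℝ → ℝ} (hg : ContDiff ℝ 1 (Function.uncurry g))
    (hv : ∀ i j, ContDiff ℝ 1 (Function.uncurry (v i j))) :
    cellInt ρ ε N (fun i j x y => g x y * deriv (fun t => v i j x t) y) +
        (∑ i ∈ Finset.Icc 1 N,
          ((∑ j ∈ Finset.range N,
            ∫ x in (xpt ρ ε N (i-1))..(xpt ρ ε N i),
              g x (xpt ρ ε N j) * jumpY ρ ε N v i j x)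
          - ∫ x in (xpt ρ ε N (i-1))..(xpt ρ ε N i),
              g x (xpt ρ ε N N) * v i N x (xpt ρ ε N N))) =
      -cellInt ρ ε N (fun i j x y => deriv (fun t => g x t) y * v i j x y) := by
  rw [cellInt_mul_deriv_right hN hg hv, sub_add_eq_add_sub,
    add_sub_assoc, ← Finset.sum_sub_distrib, Finset.sum_eq_zero, add_zero]
  intro i _
  have hjump : ∀ x, jumpY ρ ε N v i N x = -v i N x (xpt ρ ε N N) := by simp [jumpY, hN]
  simp only [Finset.sum_range_succ, hjump, mul_neg, intervalIntegral.integral_neg]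
  ring

theorem cellInt_deriv_left_add_upwind {k N : ℕ} {ρ ε : ℝ} (h : MeshHyp k N ρ ε) (lam : ℝ)
    {a g : ℝ → ℝ → ℝ} {v : ℕ → ℕ → ℝ → ℝ → ℝ} (ha : ContDiff ℝ 1 (Function.uncurry a))
    (hg : ContDiff ℝ 1 (Function.uncurry g))
    (hv : ∀ i j, ContDiff ℝ 1 (Function.uncurry (v i j)))
    (h0 : ∀ y ∈ Icc (0 : ℝ) 1, g 0 y = 0) (h1 : ∀ y ∈ Icc (0 : ℝ) 1, g 1 y = 0) :
    cellInt ρ ε N (fun i j x y => a x y * g x y * deriv (fun t => v i j t y) x) +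
        (∑ j ∈ Finset.Icc 1 N,
          ((∑ i ∈ Finset.Icc 1 N,
            ∫ y in (xpt ρ ε N (j-1))..(xpt ρ ε N j),
              a (xpt ρ ε N i) y * g (xpt ρ ε N i) y * jumpX ρ ε N v i j y)
          - lam * ∫ y in (xpt ρ ε N (j-1))..(xpt ρ ε N j),
              g (xpt ρ ε N N) y * v N j (xpt ρ ε N N) y)) =
      -cellInt ρ ε N (fun i j x y => deriv (fun t => a t y * g t y) x * v i j x y) := by
  have hN : N ≠ 0 := by have := h.2.2.1; omega
  rw [cellInt_mul_deriv_left hN (ha.uncurry_mul hg) hv, sub_add_eq_add_sub,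
    add_sub_assoc, ← Finset.sum_sub_distrib, Finset.sum_eq_zero, add_zero]
  intro j hj
  have e0 : (∫ y in (xpt ρ ε N (j-1))..(xpt ρ ε N j),
      a (xpt ρ ε N 0) y * g (xpt ρ ε N 0) y * jumpX ρ ε N v 0 j y) = 0 := by
    refine intervalIntegral.integral_zero_ae (.of_forall fun y hy => ?_)
    rw [xpt_zero, h0 y (uIcc_xpt_subset h hj (uIoc_subset_uIcc hy)), mul_zero, zero_mul]
  have e1 : (∫ y in (xpt ρ ε N (j-1))..(xpt ρ ε N j),
      g (xpt ρ ε N N) y * v N j (xpt ρ ε N N) y) = 0 := by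
    refine intervalIntegral.integral_zero_ae (.of_forall fun y hy => ?_)
    rw [xpt_self h, h1 y (uIcc_xpt_subset h hj (uIoc_subset_uIcc hy)), zero_mul]
  rw [Finset.sum_range_succ', sum_Icc_one_eq_sum_range, e0, e1, mul_zero, sub_zero, add_zero,
    sub_self]

theorem cellInt_deriv_right_add_upwind {k N : ℕ} {ρ ε : ℝ} (h : MeshHyp k N ρ ε) (lam : ℝ)
    {a g : ℝ → ℝ → ℝ} {v : ℕ → ℕ → ℝ → ℝ → ℝ} (ha : ContDiff ℝ 1 (Function.uncurry a))
    (hg : ContDiff ℝ 1 (Function.uncurry g))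
    (hv : ∀ i j, ContDiff ℝ 1 (Function.uncurry (v i j)))
    (h0 : ∀ x ∈ Icc (0 : ℝ) 1, g x 0 = 0) (h1 : ∀ x ∈ Icc (0 : ℝ) 1, g x 1 = 0) :
    cellInt ρ ε N (fun i j x y => a x y * g x y * deriv (fun t => v i j x t) y) +
        (∑ i ∈ Finset.Icc 1 N,
          ((∑ j ∈ Finset.Icc 1 N,
            ∫ x in (xpt ρ ε N (i-1))..(xpt ρ ε N i),
              a x (xpt ρ ε N j) * g x (xpt ρ ε N j) * jumpY ρ ε N v i j x)
          - lam * ∫ x in (xpt ρ ε N (i-1))..(xpt ρ ε N i),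
              g x (xpt ρ ε N N) * v i N x (xpt ρ ε N N))) =
      -cellInt ρ ε N (fun i j x y => deriv (fun t => a x t * g x t) y * v i j x y) := by
  have hag := ha.uncurry_mul hg
  have key := cellInt_deriv_left_add_upwind h lam ha.uncurry_flip hg.uncurry_flip
    (v := fun i j x y => v j i y x) (fun i j => (hv j i).uncurry_flip) h0 h1
  rw [cellInt_flip (F := fun i j x y => a x y * g x y * deriv (fun t => v i j x t) y),
    cellInt_flip (F := fun i j x y => deriv (fun t => a x t * g x t) y * v i j x y)] at key
  · exact key
  · exact fun i j => ((contDiff_deriv_right (n := 0) hag).continuous.mul (hv i j).continuous)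
  · exact fun i j => hag.continuous.mul (contDiff_deriv_right (n := 0) (hv i j)).continuous

/-! ### Linearity of the bilinear form in its first argument -/

theorem integral_sub_mul {F G J : ℝ → ℝ} (hF : Continuous F) (hG : Continuous G)
    (hJ : Continuous J) (c d : ℝ) :
    (∫ y in c..d, (F y - G y) * J y) = (∫ y in c..d, F y * J y) - ∫ y in c..d, G y * J y := by
  simp only [sub_mul]
  exact intervalIntegral.integral_sub ((hF.mul hJ).intervalIntegrable _ _)
    ((hG.mul hJ).intervalIntegrable _ _)

theorem integral_mul_sub_mul {A F G J : ℝ → ℝ} (hA : Continuous A) (hF : Continuous F)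
    (hG : Continuous G) (hJ : Continuous J) (c d : ℝ) :
    (∫ y in c..d, A y * (F y - G y) * J y) =
      (∫ y in c..d, A y * F y * J y) - ∫ y in c..d, A y * G y * J y := by
  simp only [mul_sub]
  exact integral_sub_mul (hA.mul hF) (hA.mul hG) hJ c d

section linearity

variable {ρ ε : ℝ} {N : ℕ} {F G H : ℕ → ℕ → ℝ → ℝ → ℝ} {A : ℝ → ℝ → ℝ}

theorem cellInt_sub_mul (hF : ∀ i j, Continuous (Function.uncurry (F i j)))
    (hG : ∀ i j, Continuous (Function.uncurry (G i j)))
    (hH : ∀ i j, Continuous (Function.uncurry (H i j))) :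
    cellInt ρ ε N (fun i j x y => (F i j x y - G i j x y) * H i j x y) =
      cellInt ρ ε N (fun i j x y => F i j x y * H i j x y) -
        cellInt ρ ε N (fun i j x y => G i j x y * H i j x y) := by
  simp only [sub_mul]
  exact cellInt_sub (fun i j => (hF i j).mul (hH i j)) (fun i j => (hG i j).mul (hH i j))

theorem cellInt_mul_sub_mul (hA : Continuous (Function.uncurry A))
    (hF : ∀ i j, Continuous (Function.uncurry (F i j)))
    (hG : ∀ i j, Continuous (Function.uncurry (G i j)))
    (hH : ∀ i j, Continuous (Function.uncurry (H i j))) :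
    cellInt ρ ε N (fun i j x y => A x y * (F i j x y - G i j x y) * H i j x y) =
      cellInt ρ ε N (fun i j x y => A x y * F i j x y * H i j x y) -
        cellInt ρ ε N (fun i j x y => A x y * G i j x y * H i j x y) := by
  simp only [mul_sub]
  exact cellInt_sub_mul (F := fun i j x y => A x y * F i j x y)
    (G := fun i j x y => A x y * G i j x y)
    (fun i j => hA.mul (hF i j)) (fun i j => hA.mul (hG i j)) hH

end linearity

theorem CoeffHyp.continuous_reaction {a₁ a₂ b : ℝ → ℝ → ℝ} {β : ℝ} (h : CoeffHyp a₁ a₂ b β) :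
    Continuous (Function.uncurry fun x y =>
      b x y - (deriv (fun t => a₁ t y) x + deriv (fun t => a₂ x t) y)) := by
  obtain ⟨h1, h2, h3, -⟩ := h
  exact h3.continuous.sub
    ((contDiff_deriv_left (n := 0) (h1.of_le (by norm_num))).continuous.add
      (contDiff_deriv_right (n := 0) (h2.of_le (by norm_num))).continuous)

theorem Bform_sub {ρ ε : ℝ} {N : ℕ} {a₁ a₂ b : ℝ → ℝ → ℝ} {β : ℝ} (hcoef : CoeffHyp a₁ a₂ b β)
    (lam₁ lam₂ : ℝ) {U P Q U' P' Q' v s r : ℕ → ℕ → ℝ → ℝ → ℝ}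
    (hU : ∀ i j, Continuous (Function.uncurry (U i j)))
    (hP : ∀ i j, Continuous (Function.uncurry (P i j)))
    (hQ : ∀ i j, Continuous (Function.uncurry (Q i j)))
    (hU' : ∀ i j, Continuous (Function.uncurry (U' i j)))
    (hP' : ∀ i j, Continuous (Function.uncurry (P' i j)))
    (hQ' : ∀ i j, Continuous (Function.uncurry (Q' i j)))
    (hv : ∀ i j, ContDiff ℝ 1 (Function.uncurry (v i j)))
    (hs : ∀ i j, ContDiff ℝ 1 (Function.uncurry (s i j)))
    (hr : ∀ i j, ContDiff ℝ 1 (Function.uncurry (r i j))) :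
    Bform ρ ε N a₁ a₂ b lam₁ lam₂ (fun i j x y => U i j x y - U' i j x y)
        (fun i j x y => P i j x y - P' i j x y) (fun i j x y => Q i j x y - Q' i j x y) v s r =
      Bform ρ ε N a₁ a₂ b lam₁ lam₂ U P Q v s r -
        Bform ρ ε N a₁ a₂ b lam₁ lam₂ U' P' Q' v s r := by
  have hc := hcoef.continuous_reaction
  have ha₁ := hcoef.1.continuous
  have ha₂ := hcoef.2.1.continuous
  have hv0 := fun i j => (hv i j).continuous
  have hs0 := fun i j => (hs i j).continuous
  have hr0 := fun i j => (hr i j).continuous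
  have hvx := fun i j => (contDiff_deriv_left (n := 0) (hv i j)).continuous
  have hvy := fun i j => (contDiff_deriv_right (n := 0) (hv i j)).continuous
  have hsx := fun i j => (contDiff_deriv_left (n := 0) (hs i j)).continuous
  have hry := fun i j => (contDiff_deriv_right (n := 0) (hr i j)).continuous
  have hvN := fun j => (hv0 N j).uncurry_left (xpt ρ ε N N)
  have hvN' := fun i => (hv0 i N).uncurry_right (xpt ρ ε N N)
  unfold Bform
  rw [cellInt_mul_sub_mul hc hU hU' hv0, cellInt_sub_mul hP hP' hs0, cellInt_sub_mul hQ hQ' hr0,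
    cellInt_sub_mul hU hU' hsx, cellInt_sub_mul hU hU' hry, cellInt_sub_mul hP hP' hvx,
    cellInt_sub_mul hQ hQ' hvy, cellInt_mul_sub_mul ha₁ hU hU' hvx,
    cellInt_mul_sub_mul ha₂ hU hU' hvy]
  have e1 := fun i j x c d => integral_sub_mul ((hU i j).uncurry_left x)
    ((hU' i j).uncurry_left x) (continuous_jumpX (ρ := ρ) (ε := ε) (N := N) hs0 i j) c d
  have e2 := fun i j y c d => integral_sub_mul ((hU i j).uncurry_right y)
    ((hU' i j).uncurry_right y) (continuous_jumpY (ρ := ρ) (ε := ε) (N := N) hr0 i j) c d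
  have e3 := fun i j x c d => integral_sub_mul ((hP (i + 1) j).uncurry_left x)
    ((hP' (i + 1) j).uncurry_left x) (continuous_jumpX (ρ := ρ) (ε := ε) (N := N) hv0 i j) c d
  have e4 := fun i j y c d => integral_sub_mul ((hQ i (j + 1)).uncurry_right y)
    ((hQ' i (j + 1)).uncurry_right y) (continuous_jumpY (ρ := ρ) (ε := ε) (N := N) hv0 i j) c d
  have e5 := fun i j x c d => integral_mul_sub_mul (ha₁.uncurry_left x) ((hU i j).uncurry_left x)
    ((hU' i j).uncurry_left x) (continuous_jumpX (ρ := ρ) (ε := ε) (N := N) hv0 i j) c d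
  have e6 := fun i j y c d => integral_mul_sub_mul (ha₂.uncurry_right y)
    ((hU i j).uncurry_right y) ((hU' i j).uncurry_right y)
    (continuous_jumpY (ρ := ρ) (ε := ε) (N := N) hv0 i j) c d
  have e7 := fun j x c d => integral_sub_mul ((hP N j).uncurry_left x)
    ((hP' N j).uncurry_left x) (hvN j) c d
  have e8 := fun i y c d => integral_sub_mul ((hQ i N).uncurry_right y)
    ((hQ' i N).uncurry_right y) (hvN' i) c d
  have e9 := fun j x c d => integral_sub_mul ((hU N j).uncurry_left x)
    ((hU' N j).uncurry_left x) (hvN j) c d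
  have e10 := fun i y c d => integral_sub_mul ((hU i N).uncurry_right y)
    ((hU' i N).uncurry_right y) (hvN' i) c d
  simp only [e1, e2, e3, e4, e5, e6, e7, e8, e9, e10, mul_sub lam₁, mul_sub lam₂,
    Finset.sum_sub_distrib]
  ring

/-! ### Consistency for the exact solution -/

theorem pd2_one_zero (u : ℝ → ℝ → ℝ) (x y : ℝ) : pd2 1 0 u x y = deriv (fun t => u t y) x := by
  simp [pd2]

theorem pd2_zero_one (u : ℝ → ℝ → ℝ) (x y : ℝ) : pd2 0 1 u x y = deriv (fun t => u x t) y := by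
  simp [pd2]

theorem pd2_two_zero (u : ℝ → ℝ → ℝ) (x y : ℝ) :
    pd2 2 0 u x y = deriv (fun t => deriv (fun s => u s y) t) x := by
  simp [pd2, iteratedDeriv_succ]

theorem pd2_zero_two (u : ℝ → ℝ → ℝ) (x y : ℝ) :
    pd2 0 2 u x y = deriv (fun t => deriv (fun s => u x s) t) y := by
  simp [pd2, iteratedDeriv_succ]

/-- Two continuous functions that agree on the open unit square agree on the closed one. -/
theorem eq_on_closed_square {F G : ℝ → ℝ → ℝ} (hF : Continuous (Function.uncurry F))
    (hG : Continuous (Function.uncurry G))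
    (h : ∀ x ∈ Ioo (0 : ℝ) 1, ∀ y ∈ Ioo (0 : ℝ) 1, F x y = G x y) :
    ∀ x ∈ Icc (0 : ℝ) 1, ∀ y ∈ Icc (0 : ℝ) 1, F x y = G x y := by
  intro x hx y hy
  have hEq : EqOn (Function.uncurry F) (Function.uncurry G) (Ioo (0 : ℝ) 1 ×ˢ Ioo (0 : ℝ) 1) :=
    fun p hp => h p.1 hp.1 p.2 hp.2
  have hcl := hEq.closure hF hG
  rw [closure_prod_eq, closure_Ioo zero_ne_one] at hcl
  exact hcl (show (x, y) ∈ _ from ⟨hx, hy⟩)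

theorem Bform_exact {k N : ℕ} {ρ ε : ℝ} (hmesh : MeshHyp k N ρ ε)
    {a₁ a₂ b f : ℝ → ℝ → ℝ} {β : ℝ} (hcoef : CoeffHyp a₁ a₂ b β)
    (hf : Continuous (Function.uncurry f)) (lam₁ lam₂ : ℝ)
    {u : ℝ → ℝ → ℝ} (hu : ContDiff ℝ 2 (Function.uncurry u))
    (hpde : ∀ x ∈ Ioo (0:ℝ) 1, ∀ y ∈ Ioo (0:ℝ) 1,
      -ε * (pd2 2 0 u x y + pd2 0 2 u x y) + a₁ x y * pd2 1 0 u x y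
        + a₂ x y * pd2 0 1 u x y + b x y * u x y = f x y)
    (hbc : ∀ x ∈ Icc (0:ℝ) 1, ∀ y ∈ Icc (0:ℝ) 1,
      (x = 0 ∨ x = 1 ∨ y = 0 ∨ y = 1) → u x y = 0)
    {v s r : ℕ → ℕ → ℝ → ℝ → ℝ} (hv : ∀ i j, ContDiff ℝ 1 (Function.uncurry (v i j)))
    (hs : ∀ i j, ContDiff ℝ 1 (Function.uncurry (s i j)))
    (hr : ∀ i j, ContDiff ℝ 1 (Function.uncurry (r i j))) :
    Bform ρ ε N a₁ a₂ b lam₁ lam₂ (fun _ _ x y => u x y)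
        (fun _ _ x y => ε * pd2 1 0 u x y) (fun _ _ x y => ε * pd2 0 1 u x y) v s r =
      cellInt ρ ε N (fun i j x y => f x y * v i j x y) := by
  have hN : N ≠ 0 := by have := hmesh.2.2.1; omega
  have hε : ε ≠ 0 := hmesh.2.2.2.2.1.ne'
  have hc := hcoef.continuous_reaction
  have ha₁ : ContDiff ℝ 1 (Function.uncurry a₁) := hcoef.1.of_le (by norm_num)
  have ha₂ : ContDiff ℝ 1 (Function.uncurry a₂) := hcoef.2.1.of_le (by norm_num)
  have hb := hcoef.2.2.1.continuous
  have hu1 : ContDiff ℝ 1 (Function.uncurry u) := hu.of_le (by norm_num)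
  have hux := contDiff_deriv_left (n := 1) (g := u) (by simpa [one_add_one_eq_two] using hu)
  have huy := contDiff_deriv_right (n := 1) (g := u) (by simpa [one_add_one_eq_two] using hu)
  have huxx := (contDiff_deriv_left (n := 0) hux).continuous
  have huyy := (contDiff_deriv_right (n := 0) huy).continuous
  have hp : ContDiff ℝ 1 (Function.uncurry fun x y => ε * deriv (fun t => u t y) x) :=
    contDiff_const.mul hux
  have hq : ContDiff ℝ 1 (Function.uncurry fun x y => ε * deriv (fun t => u x t) y) :=
    contDiff_const.mul huy
  have hv0 := fun i j => (hv i j).continuous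
  have hI0 : (0 : ℝ) ∈ Icc (0 : ℝ) 1 := by simp
  have hI1 : (1 : ℝ) ∈ Icc (0 : ℝ) 1 := by simp
  simp only [pd2_one_zero, pd2_zero_one, pd2_two_zero, pd2_zero_two] at hpde ⊢
  have hpde' := eq_on_closed_square
    (F := fun x y => -ε * (deriv (fun t => deriv (fun s => u s y) t) x +
      deriv (fun t => deriv (fun s => u x s) t) y) + a₁ x y * deriv (fun t => u t y) x
        + a₂ x y * deriv (fun t => u x t) y + b x y * u x y)
    ((((continuous_const.mul (huxx.add huyy)).add (ha₁.continuous.mul hux.continuous)).add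
      (ha₂.continuous.mul huy.continuous)).add (hb.mul hu1.continuous)) hf hpde
  have hx0 : ∀ y ∈ Icc (0 : ℝ) 1, u 0 y = 0 := fun y hy => hbc 0 hI0 y hy (by simp)
  have hx1 : ∀ y ∈ Icc (0 : ℝ) 1, u 1 y = 0 := fun y hy => hbc 1 hI1 y hy (by simp)
  have hy0 : ∀ x ∈ Icc (0 : ℝ) 1, u x 0 = 0 := fun x hx => hbc x hx 0 hI0 (by simp)
  have hy1 : ∀ x ∈ Icc (0 : ℝ) 1, u x 1 = 0 := fun x hx => hbc x hx 1 hI1 (by simp)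
  have i2 := cellInt_deriv_left_add_interior hmesh hu1 hs hx0 hx1
  have i2' := cellInt_deriv_right_add_interior hmesh hu1 hr hy0 hy1
  have i3 := cellInt_deriv_left_add_all (ρ := ρ) (ε := ε) hN hp hv
  have i3' := cellInt_deriv_right_add_all (ρ := ρ) (ε := ε) hN hq hv
  have i4 := cellInt_deriv_left_add_upwind hmesh lam₁ ha₁ hu1 hv hx0 hx1
  have i4' := cellInt_deriv_right_add_upwind hmesh lam₂ ha₂ hu1 hv hy0 hy1
  have iP : ε⁻¹ * cellInt ρ ε N (fun i j x y => ε * deriv (fun t => u t y) x * s i j x y) =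
      cellInt ρ ε N (fun i j x y => deriv (fun t => u t y) x * s i j x y) := by
    simp only [mul_assoc, cellInt_const_mul, inv_mul_cancel_left₀ hε]
  have iQ : ε⁻¹ * cellInt ρ ε N (fun i j x y => ε * deriv (fun t => u x t) y * r i j x y) =
      cellInt ρ ε N (fun i j x y => deriv (fun t => u x t) y * r i j x y) := by
    simp only [mul_assoc, cellInt_const_mul, inv_mul_cancel_left₀ hε]
  have c1 : ∀ i j, Continuous (Function.uncurry fun x y =>
      (b x y - (deriv (fun t => a₁ t y) x + deriv (fun t => a₂ x t) y)) * u x y * v i j x y) :=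
    fun i j => (hc.mul hu1.continuous).mul (hv0 i j)
  have c2 : ∀ i j, Continuous (Function.uncurry fun x y =>
      deriv (fun t => ε * deriv (fun t => u t y) t) x * v i j x y) :=
    fun i j => (contDiff_deriv_left (n := 0) hp).continuous.mul (hv0 i j)
  have c3 : ∀ i j, Continuous (Function.uncurry fun x y =>
      deriv (fun t => ε * deriv (fun t => u x t) t) y * v i j x y) :=
    fun i j => (contDiff_deriv_right (n := 0) hq).continuous.mul (hv0 i j)
  have c4 : ∀ i j, Continuous (Function.uncurry fun x y =>
      deriv (fun t => a₁ t y * u t y) x * v i j x y) :=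
    fun i j => (contDiff_deriv_left (n := 0) (ha₁.uncurry_mul hu1)).continuous.mul (hv0 i j)
  have c5 : ∀ i j, Continuous (Function.uncurry fun x y =>
      deriv (fun t => a₂ x t * u x t) y * v i j x y) :=
    fun i j => (contDiff_deriv_right (n := 0) (ha₂.uncurry_mul hu1)).continuous.mul (hv0 i j)
  have total : cellInt ρ ε N (fun i j x y => f x y * v i j x y) =
      cellInt ρ ε N (fun i j x y =>
        (b x y - (deriv (fun t => a₁ t y) x + deriv (fun t => a₂ x t) y)) * u x y * v i j x y)
      - cellInt ρ ε N (fun i j x y => deriv (fun t => ε * deriv (fun t => u t y) t) x * v i j x y)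
      - cellInt ρ ε N (fun i j x y => deriv (fun t => ε * deriv (fun t => u x t) t) y * v i j x y)
      + cellInt ρ ε N (fun i j x y => deriv (fun t => a₁ t y * u t y) x * v i j x y)
      + cellInt ρ ε N (fun i j x y => deriv (fun t => a₂ x t * u x t) y * v i j x y) := by
    have c12 := fun i j => (c1 i j).uncurry_sub (c2 i j)
    have c123 := fun i j => (c12 i j).uncurry_sub (c3 i j)
    have c1234 := fun i j => (c123 i j).uncurry_add (c4 i j)
    rw [← cellInt_sub c1 c2, ← cellInt_sub c12 c3, ← cellInt_add c123 c4, ← cellInt_add c1234 c5]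
    refine cellInt_congr hmesh fun i j x hx y hy => ?_
    have d1 : deriv (fun t => a₁ t y * u t y) x =
        deriv (fun t => a₁ t y) x * u x y + a₁ x y * deriv (fun t => u t y) x :=
      deriv_fun_mul ((ha₁.comp (contDiff_prodMk_left y)).differentiable one_ne_zero x)
        ((hu1.comp (contDiff_prodMk_left y)).differentiable one_ne_zero x)
    have d2 : deriv (fun t => a₂ x t * u x t) y =
        deriv (fun t => a₂ x t) y * u x y + a₂ x y * deriv (fun t => u x t) y :=
      deriv_fun_mul ((ha₂.comp (contDiff_prodMk_right x)).differentiable one_ne_zero y)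
        ((hu1.comp (contDiff_prodMk_right x)).differentiable one_ne_zero y)
    have d3 : deriv (fun t => ε * deriv (fun t => u t y) t) x =
        ε * deriv (fun t => deriv (fun s => u s y) t) x := deriv_const_mul_field ε
    have d4 : deriv (fun t => ε * deriv (fun t => u x t) t) y =
        ε * deriv (fun t => deriv (fun s => u x s) t) y := deriv_const_mul_field ε
    rw [← hpde' x hx y hy, d1, d2, d3, d4]
    ring
  unfold Bform
  linarith

theorem stmt14 (k : ℕ) (hk : 1 ≤ k) (ρ : ℝ) (hρ : (k : ℝ) + 2 ≤ ρ)
    (N : ℕ) (ε : ℝ) (hmesh : MeshHyp k N ρ ε)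
    (a₁ a₂ b f : ℝ → ℝ → ℝ) (β : ℝ) (hcoef : CoeffHyp a₁ a₂ b β)
    (hf : ContDiff ℝ (⊤ : ℕ∞) (Function.uncurry f))
    (lam₁ lam₂ : ℝ) (hlam₁ : 0 ≤ lam₁) (hlam₂ : 0 ≤ lam₂)
    (u : ℝ → ℝ → ℝ) (hu : ContDiff ℝ 2 (Function.uncurry u))
    (hpde : ∀ x ∈ Set.Ioo (0:ℝ) 1, ∀ y ∈ Set.Ioo (0:ℝ) 1,
      -ε * (pd2 2 0 u x y + pd2 0 2 u x y) + a₁ x y * pd2 1 0 u x y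
        + a₂ x y * pd2 0 1 u x y + b x y * u x y = f x y)
    (hbc : ∀ x ∈ Set.Icc (0:ℝ) 1, ∀ y ∈ Set.Icc (0:ℝ) 1,
      (x = 0 ∨ x = 1 ∨ y = 0 ∨ y = 1) → u x y = 0) :
    (∀ v s r : ℕ → ℕ → ℝ → ℝ → ℝ, IsVN k v → IsVN k s → IsVN k r →
      Bform ρ ε N a₁ a₂ b lam₁ lam₂
          (fun _ _ x y => u x y)
          (fun _ _ x y => ε * pd2 1 0 u x y)
          (fun _ _ x y => ε * pd2 0 1 u x y) v s r =
        cellInt ρ ε N (fun i j x y => f x y * v i j x y)) ∧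
    (∀ U P Q : ℕ → ℕ → ℝ → ℝ → ℝ, IsVN k U → IsVN k P → IsVN k Q →
      (∀ v s r : ℕ → ℕ → ℝ → ℝ → ℝ, IsVN k v → IsVN k s → IsVN k r →
        Bform ρ ε N a₁ a₂ b lam₁ lam₂ U P Q v s r =
          cellInt ρ ε N (fun i j x y => f x y * v i j x y)) →
      ∀ v s r : ℕ → ℕ → ℝ → ℝ → ℝ, IsVN k v → IsVN k s → IsVN k r →
        Bform ρ ε N a₁ a₂ b lam₁ lam₂
            (fun i j x y => u x y - U i j x y)
            (fun i j x y => ε * pd2 1 0 u x y - P i j x y)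
            (fun i j x y => ε * pd2 0 1 u x y - Q i j x y) v s r = 0) := by
  have hw : ContDiff ℝ 1 (Function.uncurry u) := hu.of_le (by norm_num)
  have exact_sol : ∀ v s r : ℕ → ℕ → ℝ → ℝ → ℝ, IsVN k v → IsVN k s → IsVN k r →
      Bform ρ ε N a₁ a₂ b lam₁ lam₂
          (fun _ _ x y => u x y)
          (fun _ _ x y => ε * pd2 1 0 u x y)
          (fun _ _ x y => ε * pd2 0 1 u x y) v s r =
        cellInt ρ ε N (fun i j x y => f x y * v i j x y) :=
    fun v s r hv hs hr => Bform_exact hmesh hcoef hf.continuous lam₁ lam₂ hu hpde hbc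
      (fun i j => (hv i j).contDiff) (fun i j => (hs i j).contDiff) (fun i j => (hr i j).contDiff)
  refine ⟨exact_sol, fun U P Q hU hP hQ hW v s r hv hs hr => ?_⟩
  have hp : Continuous (Function.uncurry fun x y => ε * pd2 1 0 u x y) := by
    simp only [pd2_one_zero]
    exact continuous_const.mul (contDiff_deriv_left (n := 0) hw).continuous
  have hq : Continuous (Function.uncurry fun x y => ε * pd2 0 1 u x y) := by
    simp only [pd2_zero_one]
    exact continuous_const.mul (contDiff_deriv_right (n := 0) hw).continuous
  rw [Bform_sub hcoef lam₁ lam₂ (U := fun _ _ x y => u x y)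
      (P := fun _ _ x y => ε * pd2 1 0 u x y) (Q := fun _ _ x y => ε * pd2 0 1 u x y)
      (fun _ _ => hw.continuous) (fun _ _ => hp) (fun _ _ => hq)
      (fun i j => (hU i j).contDiff (n := 0) |>.continuous)
      (fun i j => (hP i j).contDiff (n := 0) |>.continuous)
      (fun i j => (hQ i j).contDiff (n := 0) |>.continuous)
      (fun i j => (hv i j).contDiff) (fun i j => (hs i j).contDiff) (fun i j => (hr i j).contDiff),
    exact_sol v s r hv hs hr, hW v s r hv hs hr, sub_self]
end
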